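/- arXiv:1709.04435 — 4 statements merged into one kernel-verified Lean document; each statement's English description precedes it below -/
import Mathlib

section
/- Let K be a field, let A be an associative K-algebra (not necessarily commutative or unital), and let B be a K-subalgebra of A of finite codimension (i.e. the quotient vector space A/B is finite-dimensional over K). Then A is finitely presented as a K-algebra if and only if B is finitely presented as a K-algebra. -/
/-- The free non-unital associative `K`-algebra on `X`: the semigroup algebra of the free
semigroup `X⁺` over `K`. -/
abbrev FreeNUAlg (K X : Type*) [CommRing K] : Type _ := MonoidAlgebra K (FreeSemigroup X)

/-- The two-sided ideal (as a `K`-submodule closed under left and right multiplication)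
generated by a set in a non-unital `K`-algebra. -/
def idealSpan (K : Type*) {A : Type*} [CommRing K] [NonUnitalRing A] [Module K A]
    (s : Set A) : Submodule K A :=
  sInf {J : Submodule K A | s ⊆ J ∧ ∀ a b : A, b ∈ J → a * b ∈ J ∧ b * a ∈ J}

/-- A non-unital `K`-algebra is finitely generated if some finite subset generates it as a
`K`-algebra. -/
def NUAlgFG (K A : Type*) [CommRing K] [NonUnitalRing A] [Module K A]
    [IsScalarTower K A A] [SMulCommClass K A A] : Prop :=
  ∃ s : Finset A, NonUnitalAlgebra.adjoin K (s : Set A) = ⊤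

/-- A non-unital `K`-algebra is finitely presented if it is isomorphic to the quotient of a
free algebra `K⟨X⟩` on a finite set `X` by a finitely generated two-sided ideal, i.e. there
is a surjection from some `K⟨X⟩`, `X` finite, whose kernel is a finitely generated
two-sided ideal. -/
def NUAlgFP (K A : Type*) [CommRing K] [NonUnitalRing A] [Module K A]
    [IsScalarTower K A A] [SMulCommClass K A A] : Prop :=
  ∃ (n : ℕ) (f : FreeNUAlg K (Fin n) →ₙₐ[K] A),
    Function.Surjective f ∧
      ∃ s : Finset (FreeNUAlg K (Fin n)),
        ∀ x, f x = 0 ↔ x ∈ idealSpan K (s : Set (FreeNUAlg K (Fin n)))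

namespace FCod

universe u v w

/-- The free generator. -/
noncomputable def gen (K : Type*) {Y : Type*} [CommRing K] (y : Y) : FreeNUAlg K Y :=
  MonoidAlgebra.single (FreeSemigroup.of y) 1

/-- The universal property of the free algebra. -/
noncomputable def freeLift {K Y A : Type*} [CommRing K] [NonUnitalRing A] [Module K A]
    [IsScalarTower K A A] [SMulCommClass K A A] (φ : Y → A) : FreeNUAlg K Y →ₙₐ[K] A :=
  MonoidAlgebra.liftMagma K (FreeSemigroup.lift φ)

@[simp] lemma freeLift_gen {K Y A : Type*} [CommRing K] [NonUnitalRing A] [Module K A]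
    [IsScalarTower K A A] [SMulCommClass K A A] (φ : Y → A) (y : Y) :
    freeLift (K := K) φ (gen K y) = φ y := by
  simp [freeLift, gen]

lemma free_induction {K Y : Type*} [CommRing K] {P : FreeNUAlg K Y → Prop}
    (zero : P 0) (hgen : ∀ y, P (gen K y)) (hmul : ∀ y q, P q → P (gen K y * q))
    (add : ∀ a b, P a → P b → P (a + b)) (smul : ∀ (c : K) a, P a → P (c • a))
    (q : FreeNUAlg K Y) : P q := by
  induction q using MonoidAlgebra.induction_linear with
  | zero => exact zero
  | add a b ha hb => exact add a b ha hb
  | single m r =>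
    have : (MonoidAlgebra.single m r : FreeNUAlg K Y) = r • MonoidAlgebra.single m 1 := by
      simp
    rw [this]
    clear this
    apply smul
    induction m with
    | ih1 x => exact hgen x
    | ih2 x y _ hy =>
      have : (MonoidAlgebra.single (FreeSemigroup.of x * y) 1 : FreeNUAlg K Y)
        = gen K x * MonoidAlgebra.single y 1 := by
        simp [gen, MonoidAlgebra.single_mul_single]
      rw [this]
      exact hmul _ _ hy

lemma freeHom_ext {K Y A : Type*} [CommRing K] [NonUnitalRing A] [Module K A]
    [IsScalarTower K A A] [SMulCommClass K A A] (f g : FreeNUAlg K Y →ₙₐ[K] A)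
    (h : ∀ y, f (gen K y) = g (gen K y)) (q : FreeNUAlg K Y) : f q = g q := by
  induction q using free_induction with
  | zero => simp
  | hgen y => exact h y
  | hmul y q hq => simp [h, hq]
  | add a b ha hb => simp [ha, hb]
  | smul c a ha => simp [ha]

/-- left part of right-linear map. -/
noncomputable def wordFun {K Y : Type*} [CommRing K] (φ : Y → FreeNUAlg K Y) :
    FreeSemigroup Y → FreeNUAlg K Y
  | ⟨h, []⟩ => φ h
  | ⟨h, a :: t⟩ => φ h * MonoidAlgebra.single ⟨a, t⟩ 1

lemma wordFun_mul {K Y : Type*} [CommRing K] (φ : Y → FreeNUAlg K Y) (m n : FreeSemigroup Y) :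
    wordFun φ (m * n) = wordFun φ m * MonoidAlgebra.single n 1 := by
  obtain ⟨h, t⟩ := m
  obtain ⟨h', t'⟩ := n
  cases t with
  | nil => rfl
  | cons a t =>
    simp [FreeSemigroup.mk_mul_mk, wordFun, mul_assoc, MonoidAlgebra.single_mul_single]

lemma exists_rightLinear {K Y : Type*} [CommRing K] (φ : Y → FreeNUAlg K Y) :
    ∃ T : FreeNUAlg K Y →ₗ[K] FreeNUAlg K Y, (∀ y, T (gen K y) = φ y) ∧
      ∀ a b, T (a * b) = T a * b := by
  let T : FreeNUAlg K Y →ₗ[K] FreeNUAlg K Y :=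
    (Finsupp.linearCombination K (wordFun φ)) ∘ₗ
      (MonoidAlgebra.coeffLinearEquiv K : FreeNUAlg K Y ≃ₗ[K] _).toLinearMap
  have hT : ∀ m (r : K), T (MonoidAlgebra.single m r) = r • wordFun φ m := by
    intro m r
    simp [T]
  refine ⟨T, fun y => ?_, fun a b => ?_⟩
  · simp [gen, hT, wordFun, FreeSemigroup.of]
  · induction a using MonoidAlgebra.induction_linear with
    | zero => simp
    | add a a' ha ha' => simp [add_mul, ha, ha']
    | single m r =>
      induction b using MonoidAlgebra.induction_linear with
      | zero => simp
      | add a a' ha ha' => simp [mul_add, ha, ha']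
      | single n s =>
        have : (MonoidAlgebra.single n s : FreeNUAlg K Y) = s • MonoidAlgebra.single n 1 := by
          simp
        rw [MonoidAlgebra.single_mul_single, hT, hT, wordFun_mul, this, smul_mul_assoc,
          mul_smul_comm, smul_smul]

section ideal
variable {K A C : Type*} [CommRing K] [NonUnitalRing A] [Module K A] [NonUnitalRing C] [Module K C]

lemma subset_idealSpan {s : Set A} {x : A} (h : x ∈ s) : x ∈ idealSpan K s := by
  simp only [idealSpan, Submodule.mem_sInf]
  exact fun J hJ => hJ.1 h

lemma idealSpan_mul {s : Set A} (a : A) {b : A} (h : b ∈ idealSpan K s) :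
    a * b ∈ idealSpan K s := by
  simp only [idealSpan, Submodule.mem_sInf] at h ⊢
  exact fun J hJ => (hJ.2 a b (h J hJ)).1

lemma mul_idealSpan {s : Set A} (a : A) {b : A} (h : b ∈ idealSpan K s) :
    b * a ∈ idealSpan K s := by
  simp only [idealSpan, Submodule.mem_sInf] at h ⊢
  exact fun J hJ => (hJ.2 a b (h J hJ)).2

lemma idealSpan_le {s : Set A} (J : Submodule K A) (h1 : ∀ x ∈ s, x ∈ J)
    (h2 : ∀ a b, b ∈ J → a * b ∈ J) (h3 : ∀ a b, b ∈ J → b * a ∈ J) {x : A}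
    (hx : x ∈ idealSpan K s) : x ∈ J := by
  simp only [idealSpan, Submodule.mem_sInf] at hx
  exact hx J ⟨h1, fun a b hb => ⟨h2 a b hb, h3 a b hb⟩⟩

lemma idealSpan_map (f : A →ₙₐ[K] C) {s : Set A} {t : Set C} (h : ∀ x ∈ s, f x ∈ idealSpan K t)
    {x : A} (hx : x ∈ idealSpan K s) : f x ∈ idealSpan K t := by
  refine idealSpan_le ((idealSpan K t).comap (f : A →ₗ[K] C)) h ?_ ?_ hx
  · intro a b hb
    simp only [Submodule.mem_comap, LinearMap.coe_coe] at hb ⊢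
    simpa using idealSpan_mul _ hb
  · intro a b hb
    simp only [Submodule.mem_comap, LinearMap.coe_coe] at hb ⊢
    simpa using mul_idealSpan _ hb

end ideal

lemma fp_of_finite {K A Y : Type*} [CommRing K] [NonUnitalRing A] [Module K A]
    [IsScalarTower K A A] [SMulCommClass K A A] [Finite Y] (f : FreeNUAlg K Y →ₙₐ[K] A)
    (hf : Function.Surjective f) (s : Set (FreeNUAlg K Y)) (hs : s.Finite)
    (hker : ∀ x, f x = 0 ↔ x ∈ idealSpan K s) : NUAlgFP K A := by
  classical
  obtain ⟨n, ⟨e⟩⟩ := Finite.exists_equiv_fin Y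
  let p : FreeNUAlg K (Fin n) →ₙₐ[K] FreeNUAlg K Y := freeLift fun i => gen K (e.symm i)
  let p' : FreeNUAlg K Y →ₙₐ[K] FreeNUAlg K (Fin n) := freeLift fun y => gen K (e y)
  have h1 : ∀ q, p (p' q) = q := freeHom_ext (p.comp p') (NonUnitalAlgHom.id K _) (by
    intro y; simp [p, p'])
  have h2 : ∀ q, p' (p q) = q := freeHom_ext (p'.comp p) (NonUnitalAlgHom.id K _) (by
    intro y; simp [p, p'])
  refine ⟨n, f.comp p, ?_, (hs.image p').toFinset, fun x => ?_⟩
  · intro a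
    obtain ⟨q, rfl⟩ := hf a
    exact ⟨p' q, by simp [h1]⟩
  · simp only [NonUnitalAlgHom.comp_apply, Set.Finite.coe_toFinset]
    rw [hker]
    constructor
    · intro h
      rw [← h2 x]
      exact idealSpan_map p' (fun y hy => subset_idealSpan (Set.mem_image_of_mem _ hy)) h
    · refine idealSpan_map p ?_
      rintro _ ⟨y, hy, rfl⟩
      rw [h1]
      exact subset_idealSpan hy


set_option maxHeartbeats 1000000 in
lemma fp_of_sub {K A : Type*} [Field K]
    [NonUnitalRing A] [Module K A] [IsScalarTower K A A] [SMulCommClass K A A]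
    (B : NonUnitalSubalgebra K A)
    (hB : FiniteDimensional K (A ⧸ B.toSubmodule)) (h : NUAlgFP K B) : NUAlgFP K A := by
  classical
  obtain ⟨n, f, hf, R, hR⟩ := h
  let b := Module.finBasis K (A ⧸ B.toSubmodule)
  set m := Module.finrank K (A ⧸ B.toSubmodule)
  choose w hw using fun s => Submodule.mkQ_surjective B.toSubmodule (b s)
  let F : FreeNUAlg K (Fin n ⊕ Fin m) →ₙₐ[K] A :=
    freeLift (Sum.elim (fun i => (f (gen K i) : A)) w)
  let j : FreeNUAlg K (Fin n) →ₙₐ[K] FreeNUAlg K (Fin n ⊕ Fin m) :=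
    freeLift fun i => gen K (Sum.inl i)
  let z : Fin m → FreeNUAlg K (Fin n ⊕ Fin m) := fun s => gen K (Sum.inr s)
  have hFz : ∀ s, F (z s) = w s := fun s => by simp [F, z]
  have hFj : ∀ q, F (j q) = (f q : A) :=
    freeHom_ext (F.comp j) ((NonUnitalSubalgebraClass.subtype B).comp f) (by
      intro y; simp [F, j])
  -- normal forms
  have hnf : ∀ a : A, ∃ (c : Fin m → K) (q : FreeNUAlg K (Fin n)),
      F (∑ s, c s • z s + j q) = a := by
    intro a
    let c := b.repr (B.toSubmodule.mkQ a)
    have h1 : a - ∑ s, c s • w s ∈ B.toSubmodule := by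
      rw [← Submodule.ker_mkQ B.toSubmodule, LinearMap.mem_ker, map_sub, map_sum]
      simp only [map_smul, hw]
      rw [b.sum_repr, sub_self]
    obtain ⟨q, hq⟩ := hf ⟨_, h1⟩
    refine ⟨c, q, ?_⟩
    rw [map_add, hFj, hq, map_sum]
    simp [hFz]
  choose c q hcq using hnf
  let nf : A → FreeNUAlg K (Fin n ⊕ Fin m) := fun a => ∑ s, c a s • z s + j (q a)
  have hnfF : ∀ a, F (nf a) = a := hcq
  let r1 : (Fin n ⊕ Fin m) × Fin m → FreeNUAlg K (Fin n ⊕ Fin m) := fun p =>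
    gen K p.1 * z p.2 - nf (F (gen K p.1 * z p.2))
  let r2 : (Fin n ⊕ Fin m) × Fin m → FreeNUAlg K (Fin n ⊕ Fin m) := fun p =>
    z p.2 * gen K p.1 - nf (F (z p.2 * gen K p.1))
  let S : Set (FreeNUAlg K (Fin n ⊕ Fin m)) := j '' (R : Set _) ∪ (Set.range r1 ∪ Set.range r2)
  have hS : S.Finite := (R.finite_toSet.image j).union
    ((Set.finite_range r1).union (Set.finite_range r2))
  let N : Submodule K (FreeNUAlg K (Fin n ⊕ Fin m)) :=
    Submodule.span K (Set.range z) ⊔ LinearMap.range (j : FreeNUAlg K (Fin n) →ₗ[K] FreeNUAlg K (Fin n ⊕ Fin m))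
      ⊔ idealSpan K S
  have hzN : ∀ s, z s ∈ N := fun s => Submodule.mem_sup_left
    (Submodule.mem_sup_left (Submodule.subset_span ⟨s, rfl⟩))
  have hjN : ∀ q, j q ∈ N := fun q => Submodule.mem_sup_left
    (Submodule.mem_sup_right ⟨q, rfl⟩)
  have hIN : ∀ x ∈ idealSpan K S, x ∈ N := fun x hx => Submodule.mem_sup_right hx
  have hnN : ∀ a, nf a ∈ N := fun a =>
    N.add_mem (N.sum_mem fun s _ => N.smul_mem _ (hzN s)) (hjN _)
  have hr1 : ∀ x s, gen K x * z s - nf (F (gen K x * z s)) ∈ idealSpan K S := fun x s =>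
    subset_idealSpan (Or.inr (Or.inl ⟨(x, s), rfl⟩))
  have hr2 : ∀ x s, z s * gen K x - nf (F (z s * gen K x)) ∈ idealSpan K S := fun x s =>
    subset_idealSpan (Or.inr (Or.inr ⟨(x, s), rfl⟩))
  have key : ∀ q s, z s * j q ∈ N := by
    intro q
    induction q using free_induction with
    | zero => intro s; simp
    | hgen y =>
      intro s
      have : j (gen K y) = gen K (Sum.inl y) := by simp [j]
      rw [this, ← sub_add_cancel (z s * _) (nf (F (z s * gen K (Sum.inl y))))]
      exact N.add_mem (hIN _ (hr2 _ _)) (hnN _)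
    | hmul y p hp =>
      intro s
      have : j (gen K y) = gen K (Sum.inl y) := by simp [j]
      rw [map_mul, this, ← mul_assoc,
        ← sub_add_cancel (z s * _) (nf (F (z s * gen K (Sum.inl y)))), add_mul]
      refine N.add_mem (hIN _ (mul_idealSpan _ (hr2 _ _))) ?_
      simp only [nf, add_mul, Finset.sum_mul, smul_mul_assoc]
      refine N.add_mem (N.sum_mem fun t _ => N.smul_mem _ (hp t)) ?_
      rw [← map_mul]
      exact hjN _
    | add a b ha hb => intro s; rw [map_add, mul_add]; exact N.add_mem (ha s) (hb s)
    | smul c a ha => intro s; rw [map_smul, mul_smul_comm]; exact N.smul_mem _ (ha s)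
  have hgenN : ∀ x, ∀ y ∈ N, gen K x * y ∈ N := by
    intro x y hy
    obtain ⟨y1, hy1, y2, hy2, rfl⟩ := Submodule.mem_sup.1 hy
    obtain ⟨y3, hy3, y4, ⟨p, rfl⟩, rfl⟩ := Submodule.mem_sup.1 hy1
    rw [mul_add, mul_add]
    refine N.add_mem (N.add_mem ?_ ?_) (hIN _ (idealSpan_mul _ hy2))
    · clear hy hy1
      induction hy3 using Submodule.span_induction with
      | mem t ht =>
        obtain ⟨s, rfl⟩ := ht
        rw [← sub_add_cancel (gen K x * z s) (nf (F (gen K x * z s)))]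
        exact N.add_mem (hIN _ (hr1 _ _)) (hnN _)
      | zero => simp
      | add a b _ _ ha hb => rw [mul_add]; exact N.add_mem ha hb
      | smul c a _ ha => rw [mul_smul_comm]; exact N.smul_mem _ ha
    · cases x with
      | inl x =>
        have : gen K (Sum.inl x) = j (gen K x) := by simp [j]
        rw [this]
        change j _ * j p ∈ N
        rw [← map_mul]
        exact hjN _
      | inr s => exact key p s
  have hN : ∀ x, x ∈ N := by
    intro x
    induction x using free_induction with
    | zero => exact N.zero_mem
    | hgen y =>
      cases y with
      | inl x =>
        have : gen K (Sum.inl x) = j (gen K x) := by simp [j]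
        rw [this]
        exact hjN _
      | inr s => exact hzN s
    | hmul y q hq => exact hgenN _ _ hq
    | add a b ha hb => exact N.add_mem ha hb
    | smul c a ha => exact N.smul_mem _ ha
  have hIker : ∀ x ∈ idealSpan K S, F x = 0 := by
    intro x hx
    refine idealSpan_le (LinearMap.ker (F : FreeNUAlg K (Fin n ⊕ Fin m) →ₗ[K] A)) ?_ ?_ ?_ hx
    · rintro x (⟨y, hy, rfl⟩ | ⟨p, rfl⟩ | ⟨p, rfl⟩)
      · change F (j y) = 0
        rw [hFj, (hR y).2 (subset_idealSpan hy)]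
        rfl
      · change F (_ - _) = 0
        rw [map_sub, hnfF, sub_self]
      · change F (_ - _) = 0
        rw [map_sub, hnfF, sub_self]
    · intro a b hb
      change F b = 0 at hb
      change F (a * b) = 0
      rw [map_mul, hb, mul_zero]
    · intro a b hb
      change F b = 0 at hb
      change F (b * a) = 0
      rw [map_mul, hb, zero_mul]
  refine fp_of_finite F (fun a => ⟨nf a, hnfF a⟩) S hS fun x => ⟨fun hx => ?_, hIker x⟩
  obtain ⟨y1, hy1, y2, hy2, rfl⟩ := Submodule.mem_sup.1 (hN x)
  obtain ⟨y3, hy3, y4, ⟨p, rfl⟩, rfl⟩ := Submodule.mem_sup.1 hy1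
  obtain ⟨d, rfl⟩ := (Submodule.mem_span_range_iff_exists_fun K).1 hy3
  change F (_ + j p + _) = 0 at hx
  rw [map_add, hIker _ hy2, add_zero, map_add, hFj, map_sum] at hx
  simp only [map_smul, hFz] at hx
  have h0 : ∑ s, d s • b s = 0 := by
    have := congrArg B.toSubmodule.mkQ hx
    rw [map_add, map_sum, map_zero] at this
    simp only [map_smul, hw] at this
    have h2 : B.toSubmodule.mkQ (f p : A) = 0 :=
      (Submodule.Quotient.mk_eq_zero B.toSubmodule).2 (f p).2
    rw [h2, add_zero] at this
    exact this
  have hd : ∀ s, d s = 0 := Fintype.linearIndependent_iff.1 b.linearIndependent d h0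
  simp only [hd, zero_smul, Finset.sum_const_zero, zero_add] at hx ⊢
  refine Submodule.add_mem _ ?_ hy2
  refine idealSpan_map j (s := (R : Set _)) ?_ ((hR p).1 (Subtype.ext hx))
  exact fun y hy => subset_idealSpan (Or.inl (Set.mem_image_of_mem _ hy))


lemma bilin_mem {K V Q S : Type*} [Field K] [AddCommGroup V] [Module K V] [AddCommGroup Q]
    [Module K Q] (b : Module.Basis S K V) (N : Submodule K Q) (φ : V →ₗ[K] V →ₗ[K] Q)
    (h : ∀ s t, φ (b s) (b t) ∈ N) (v w : V) : φ v w ∈ N := by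
  have h1 : ∀ s w, φ (b s) w ∈ N := by
    intro s w
    have : Submodule.span K (Set.range b) ≤ N.comap (φ (b s)) := by
      rw [Submodule.span_le]
      rintro _ ⟨t, rfl⟩
      exact h s t
    exact this (b.mem_span w)
  have : Submodule.span K (Set.range b) ≤ N.comap (φ.flip w) := by
    rw [Submodule.span_le]
    rintro _ ⟨t, rfl⟩
    exact h1 t w
  exact this (b.mem_span v)

set_option maxHeartbeats 1000000 in
lemma fp_ideal_aux {K U I V : Type*} [Field K] [Ring U] [Algebra K U] [NonUnitalRing I]
    [Module K I] [IsScalarTower K I I] [SMulCommClass K I I] {n : ℕ}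
    (f : FreeAlgebra K (Fin n) →ₐ[K] U) (R : Finset (FreeAlgebra K (Fin n)))
    (hR : ∀ r ∈ R, f r = 0)
    (hker : ∀ g, f g = 0 → g ∈ idealSpan K (R : Set (FreeAlgebra K (Fin n))))
    (i : I →ₙₐ[K] U) (hi : Function.Injective i)
    (hs : ∀ a, ∃ g, f g = i a)
    [AddCommGroup V] [Module K V] [Module (FreeAlgebra K (Fin n)) V]
    [IsScalarTower K (FreeAlgebra K (Fin n)) V] [FiniteDimensional K V]
    (hJ : ∀ g, (∀ v : V, g • v = 0) ↔ ∃ a, i a = f g)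
    (o : V) (ho : ∀ g : FreeAlgebra K (Fin n), g • o = 0 → ∀ v : V, g • v = 0)
    (l : V →ₗ[K] FreeAlgebra K (Fin n))
    (hl : ∀ v, l v • o = v) (hlo : l o = 1) : NUAlgFP K I := by
  classical
  let G := FreeAlgebra K (Fin n)
  let X : Fin n → G := FreeAlgebra.ι K
  let b := Module.finBasis K V
  set m := Module.finrank K V
  let Q := FreeNUAlg K (Fin m × Fin n × Fin m)
  let yy : Fin n → V →ₗ[K] V →ₗ[K] Q := fun x =>
    b.constr K fun t => b.constr K fun s => gen K (t, x, s)
  have hyy : ∀ t x s, yy x (b t) (b s) = gen K (t, x, s) := by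
    intro t x s
    simp [yy]
  -- the elements `e`
  let e : Fin n → V → G := fun x v => X x * l v - l (X x • v)
  have hsmul : ∀ (c : K) (g : G) (v : V), g • (c • v) = c • (g • v) := by
    intro c g v
    rw [← algebraMap_smul G c v, ← algebraMap_smul G c (g • v), smul_smul, smul_smul,
      Algebra.commutes]
  have e_add : ∀ x v w, e x (v + w) = e x v + e x w := by
    intro x v w
    simp only [e, map_add, smul_add, mul_add]; abel
  have e_smul : ∀ x (c : K) v, e x (c • v) = c • e x v := by
    intro x c v
    simp only [e, map_smul, hsmul, mul_smul_comm, smul_sub]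
  have heJ : ∀ x w (v : V), e x w • v = 0 := by
    intro x w
    apply ho
    simp only [e, sub_smul, mul_smul, hl, sub_self]
  have hXl : ∀ x v, X x * l v = l (X x • v) + e x v := by
    intro x v; simp only [e]; abel
  have hleJ : ∀ v x w, ∃ a, i a = f (l v * e x w) := by
    intro v x w
    rw [← hJ]
    intro u
    rw [mul_smul, heJ, smul_zero]
  choose pe hpe using hleJ
  let π : Q →ₙₐ[K] I := freeLift fun p => pe (b p.1) p.2.1 (b p.2.2)
  have hπgen : ∀ p, π (gen K p) = pe (b p.1) p.2.1 (b p.2.2) := fun p => freeLift_gen _ p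
  have bilin_ext : ∀ (x : Fin n) (φ : V →ₗ[K] V →ₗ[K] U) (h : ∀ s t, φ (b s) (b t) = 0) v w,
      φ v w = 0 := by
    intro x φ h v w
    have := bilin_mem b (⊥ : Submodule K U) φ (by simpa using h) v w
    simpa using this
  have hπyy : ∀ x v w, i (π (yy x v w)) = f (l v * e x w) := by
    intro x v w
    rw [← sub_eq_zero]
    refine bilin_ext x (LinearMap.mk₂ K (fun v w => i (π (yy x v w)) - f (l v * e x w))
      ?_ ?_ ?_ ?_) ?_ v w
    · intro v v' w
      simp only [map_add, LinearMap.add_apply, add_mul]; abel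
    · intro c v w
      simp only [map_smul, LinearMap.smul_apply, smul_mul_assoc, smul_sub]
    · intro v w w'
      simp only [map_add, e_add, mul_add]; abel
    · intro c v w
      simp only [map_smul, e_smul, mul_smul_comm, smul_sub]
    · intro s t
      simp only [LinearMap.mk₂_apply, hyy]
      rw [hπgen, hpe, sub_self]
  -- the action on `Q`
  choose T0 hT0 hT0m using fun x : Fin n => exists_rightLinear (K := K)
    (Y := Fin m × Fin n × Fin m) fun p =>
      yy p.2.1 (X x • b p.1) (b p.2.2) + yy x o (b p.1) * yy p.2.1 o (b p.2.2)
  have hT0yy : ∀ x x' v w, T0 x (yy x' v w) = yy x' (X x • v) w + yy x o v * yy x' o w := by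
    intro x x' v w
    rw [← sub_eq_zero, ← Submodule.mem_bot K]
    refine bilin_mem b ⊥ (LinearMap.mk₂ K
      (fun v w => T0 x (yy x' v w) - (yy x' (X x • v) w + yy x o v * yy x' o w))
      ?_ ?_ ?_ ?_) ?_ v w
    · intro v v' w
      simp only [map_add, LinearMap.add_apply, add_mul, smul_add]; abel
    · intro c v w
      simp only [map_smul, LinearMap.smul_apply, smul_mul_assoc, smul_sub, hsmul, smul_add]
    · intro v w w'
      simp only [map_add, mul_add]; abel
    · intro c v w
      simp only [map_smul, mul_smul_comm, smul_sub, smul_add]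
    · intro s t
      simp only [LinearMap.mk₂_apply, hyy, hT0, sub_self, Submodule.zero_mem]
  let T : G →ₐ[K] Module.End K Q := FreeAlgebra.lift K T0
  have hTX : ∀ x q, T (X x) q = T0 x q := by
    intro x q; exact DFunLike.congr_fun (FreeAlgebra.lift_ι_apply T0 x) q
  have hTone : ∀ q, T 1 q = q := fun q => by rw [map_one]; rfl
  have hTmul : ∀ g h q, T (g * h) q = T g (T h q) := fun g h q => by rw [map_mul]; rfl
  have hTadd : ∀ g h q, T (g + h) q = T g q + T h q := fun g h q => by rw [map_add]; rfl
  have hTsmul : ∀ (c : K) h q, T (c • h) q = c • T h q := fun g h q => by rw [map_smul]; rfl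
  have hTalg : ∀ c q, T (algebraMap K G c) q = c • q := fun c q => by
    rw [AlgHom.commutes]; rfl
  have hTr : ∀ g q q', T g (q * q') = T g q * q' := by
    intro g
    induction g using FreeAlgebra.induction with
    | grade0 c => intro q q'; rw [hTalg, hTalg, smul_mul_assoc]
    | grade1 x => intro q q'; rw [← show X x = FreeAlgebra.ι K x from rfl, hTX, hTX, hT0m]
    | mul g h hg hh => intro q q'; rw [hTmul, hTmul, hh, hg]
    | add g h hg hh => intro q q'; rw [hTadd, hTadd, hh, hg, add_mul]
  -- the action on `V × Q`
  have hact : ∀ x : Fin n, ∃ L : Module.End K (V × Q), ∀ v q,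
      L (v, q) = (X x • v, yy x o v + T0 x q) := by
    intro x
    refine ⟨{ toFun := fun p => (X x • p.1, yy x o p.1 + T0 x p.2), map_add' := ?_,
              map_smul' := ?_ }, fun v q => rfl⟩
    · intro p p'
      ext1
      · simp [smul_add]
      · simp only [Prod.fst_add, Prod.snd_add, map_add]; abel
    · intro c p
      ext1
      · simp [hsmul]
      · simp only [Prod.smul_fst, Prod.smul_snd, map_smul, smul_add, RingHom.id_apply]
  choose L hL using hact
  let Φ : G →ₐ[K] Module.End K (V × Q) := FreeAlgebra.lift K L
  have hΦX : ∀ x p, Φ (X x) p = L x p := by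
    intro x q; exact DFunLike.congr_fun (FreeAlgebra.lift_ι_apply L x) q
  have hΦmul : ∀ g h q, Φ (g * h) q = Φ g (Φ h q) := fun g h q => by rw [map_mul]; rfl
  have hΦadd : ∀ g h q, Φ (g + h) q = Φ g q + Φ h q := fun g h q => by rw [map_add]; rfl
  have hΦsmul : ∀ (c : K) h q, Φ (c • h) q = c • Φ h q := fun g h q => by rw [map_smul]; rfl
  have hΦalg : ∀ c q, Φ (algebraMap K G c) q = c • q := fun c q => by
    rw [AlgHom.commutes]; rfl
  have hΦ1 : ∀ g p, (Φ g p).1 = g • p.1 := by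
    intro g
    induction g using FreeAlgebra.induction with
    | grade0 c => intro p; rw [hΦalg, algebraMap_smul]; rfl
    | grade1 x => rintro ⟨v, q⟩; rw [← show X x = FreeAlgebra.ι K x from rfl, hΦX, hL]
    | mul g h hg hh => intro q; rw [hΦmul, hg, hh, mul_smul]
    | add g h hg hh => intro q; rw [hΦadd, Prod.fst_add, hh, hg, add_smul]
  have hΦ2 : ∀ g q, Φ g (0, q) = (0, T g q) := by
    intro g
    induction g using FreeAlgebra.induction with
    | grade0 c => intro q; rw [hΦalg, hTalg]; simp
    | grade1 x => intro q; rw [← show X x = FreeAlgebra.ι K x from rfl, hΦX, hL, hTX]; simp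
    | mul g h hg hh => intro q; rw [hΦmul, hh, hg, hTmul]
    | add g h hg hh => intro q; rw [hΦadd, hh, hg, hTadd]; simp
  let τ : G → V → Q := fun g v => (Φ g (v, 0)).2
  have hΦv : ∀ g v, Φ g (v, 0) = (g • v, τ g v) := fun g v => Prod.ext (hΦ1 _ _) rfl
  have hΦvq : ∀ g v q, Φ g (v, q) = (g • v, τ g v + T g q) := by
    intro g v q
    have : ((v, q) : V × Q) = (v, 0) + (0, q) := by simp
    rw [this, map_add, hΦv, hΦ2]; simp
  have τ_mul : ∀ g h v, τ (g * h) v = τ g (h • v) + T g (τ h v) := by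
    intro g h v
    have := hΦmul g h (v, 0)
    rw [hΦv, hΦv, hΦvq] at this
    exact (Prod.ext_iff.1 this).2
  have τ_X : ∀ x v, τ (X x) v = yy x o v := by
    intro x v
    simp only [τ, hΦX, hL, map_zero, add_zero]
  have τ_add : ∀ g h v, τ (g + h) v = τ g v + τ h v := by
    intro g h v
    simp only [τ, hΦadd, Prod.snd_add]
  have τ_smul : ∀ (c : K) h v, τ (c • h) v = c • τ h v := by
    intro g h v
    simp only [τ, hΦsmul, Prod.smul_snd]
  have τ_add' : ∀ g v w, τ g (v + w) = τ g v + τ g w := by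
    intro g v w
    have : ((v + w, 0) : V × Q) = (v, 0) + (w, 0) := by simp
    simp only [τ, this, map_add, Prod.snd_add]
  have τ_smul' : ∀ (c : K) g v, τ g (c • v) = c • τ g v := by
    intro c g v
    have : ((c • v, 0) : V × Q) = c • (v, 0) := by simp
    simp only [τ, this, map_smul, Prod.smul_snd]
  have τ_alg : ∀ c v, τ (algebraMap K G c) v = 0 := by
    intro c v
    simp only [τ, hΦalg, Prod.smul_snd, smul_zero]
  have hTyy : ∀ g x v w, T g (yy x v w) = yy x (g • v) w + τ g v * yy x o w := by
    intro g
    induction g using FreeAlgebra.induction with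
    | grade0 c =>
      intro x v w
      rw [hTalg, τ_alg, algebraMap_smul, map_smul, LinearMap.smul_apply, zero_mul, add_zero]
    | grade1 x' =>
      intro x v w
      rw [← show X x' = FreeAlgebra.ι K x' from rfl, hTX, hT0yy, τ_X]
    | mul g h hg hh =>
      intro x v w
      rw [hTmul, hh, map_add, hg, hTr, τ_mul, add_mul, mul_smul, add_assoc]
    | add g h hg hh =>
      intro x v w
      rw [hTadd, hh, hg, τ_add, add_mul, add_smul, map_add, LinearMap.add_apply]; abel
  -- compatibility with π
  have hπT : ∀ g q, i (π (T g q)) = f g * i (π q) := by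
    intro g
    induction g using FreeAlgebra.induction with
    | grade0 c =>
      intro q
      rw [hTalg, map_smul, map_smul, AlgHom.commutes, Algebra.smul_def]
    | grade1 x =>
      intro q
      rw [← show X x = FreeAlgebra.ι K x from rfl, hTX]
      have hg : ∀ y, i (π (T0 x (gen K y))) = f (X x) * i (π (gen K y)) := by
        rintro ⟨t, x', s⟩
        rw [← hyy, hT0yy, map_add, map_add, map_mul, map_mul]
        simp only [hπyy, hlo, one_mul]
        rw [← map_mul, ← map_mul, ← map_add, ← mul_assoc, hXl, add_mul]
      induction q using free_induction with
      | zero => simp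
      | hgen y => exact hg y
      | hmul y q hq => rw [hT0m, map_mul, map_mul, hg, map_mul, map_mul, mul_assoc]
      | add a b ha hb => simp only [map_add, ha, hb, mul_add]
      | smul c a ha => simp only [map_smul, ha, mul_smul_comm]
    | mul g h hg hh => intro q; rw [hTmul, hg, hh, map_mul, mul_assoc]
    | add g h hg hh => intro q; rw [hTadd, map_add, map_add, hg, hh, map_add, add_mul]
  have hπτ : ∀ g v, f (g * l v) = f (l (g • v)) + i (π (τ g v)) := by
    intro g
    induction g using FreeAlgebra.induction with
    | grade0 c =>
      intro v
      rw [τ_alg, algebraMap_smul, map_zero, map_zero, add_zero, map_smul, Algebra.smul_def]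
    | grade1 x =>
      intro v
      rw [← show X x = FreeAlgebra.ι K x from rfl, τ_X, hπyy, hlo, one_mul, hXl, map_add]
    | mul g h hg hh =>
      intro v
      rw [mul_assoc, map_mul, hh, mul_add, ← map_mul, hg, τ_mul, map_add, map_add, hπT,
        mul_smul, add_assoc]
    | add g h hg hh =>
      intro v
      rw [add_mul, map_add, hg, hh, τ_add, add_smul, map_add, map_add, map_add, map_add]
      abel
  have hπρ : ∀ g : G, (∀ v : V, g • v = 0) → i (π (τ g o)) = f g := by
    intro g hg
    have := hπτ g o
    rw [hlo, mul_one, hg, map_zero, map_zero, zero_add] at this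
    exact this.symm
  -- relations
  let rS : (Fin m × Fin n × Fin m) × (Fin m × Fin n × Fin m) → Q := fun p =>
    T (l (b p.1.1) * e p.1.2.1 (b p.1.2.2)) (gen K p.2) - gen K p.1 * gen K p.2
  let rC : Fin m × Fin n × Fin m → Q := fun p =>
    τ (l (b p.1) * e p.2.1 (b p.2.2)) o - gen K p
  let rD : Fin m × R × Fin m → Q := fun p => T (l (b p.1)) (τ p.2.1 (b p.2.2))
  let S : Set Q := Set.range rS ∪ (Set.range rC ∪ Set.range rD)
  have hSfin : S.Finite := (Set.finite_range rS).union
    ((Set.finite_range rC).union (Set.finite_range rD))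
  let N : Submodule K Q := idealSpan K S
  have hNl : ∀ a b : Q, b ∈ N → a * b ∈ N := fun a b hb => idealSpan_mul a hb
  have hNr : ∀ a b : Q, b ∈ N → b * a ∈ N := fun a b hb => mul_idealSpan a hb
  have hS0 : ∀ x v w p, T (l v * e x w) (gen K p) - yy x v w * gen K p ∈ N := by
    intro x v w p
    refine bilin_mem b N (LinearMap.mk₂ K
      (fun v w => T (l v * e x w) (gen K p) - yy x v w * gen K p) ?_ ?_ ?_ ?_) ?_ v w
    · intro v v' w
      simp only [map_add, LinearMap.add_apply, add_mul, hTadd]; abel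
    · intro c v w
      simp only [map_smul, LinearMap.smul_apply, smul_mul_assoc, smul_sub]
    · intro v w w'
      rw [e_add, mul_add, hTadd, map_add, add_mul]; abel
    · intro c v w
      rw [e_smul, mul_smul_comm, hTsmul, map_smul, smul_mul_assoc, smul_sub]
    · intro s t
      simp only [LinearMap.mk₂_apply, hyy]
      exact subset_idealSpan (Or.inl ⟨((s, x, t), p), rfl⟩)
  have hSq : ∀ x v w q, T (l v * e x w) q - yy x v w * q ∈ N := by
    intro x v w q
    induction q using free_induction with
    | zero => simp
    | hgen p => exact hS0 x v w p
    | hmul p q _ =>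
      rw [hTr, ← mul_assoc, ← sub_mul]
      exact hNr _ _ (hS0 x v w p)
    | add a b ha hb =>
      rw [map_add, mul_add, add_sub_add_comm]
      exact N.add_mem ha hb
    | smul c a ha =>
      rw [map_smul, mul_smul_comm, ← smul_sub]
      exact N.smul_mem _ ha
  have hSe : ∀ x w q, T (e x w) q - yy x o w * q ∈ N := by
    intro x w q
    have := hSq x o w q
    rwa [hlo, one_mul] at this
  have hC : ∀ x v w, τ (l v * e x w) o - yy x v w ∈ N := by
    intro x v w
    refine bilin_mem b N (LinearMap.mk₂ K
      (fun v w => τ (l v * e x w) o - yy x v w) ?_ ?_ ?_ ?_) ?_ v w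
    · intro v v' w
      simp only [map_add, LinearMap.add_apply, add_mul, τ_add]; abel
    · intro c v w
      simp only [map_smul, LinearMap.smul_apply, smul_mul_assoc, smul_sub, τ_smul]
    · intro v w w'
      simp only [map_add, e_add, mul_add, τ_add]; abel
    · intro c v w
      simp only [map_smul, e_smul, mul_smul_comm, smul_sub, τ_smul]
    · intro s t
      simp only [LinearMap.mk₂_apply, hyy]
      exact subset_idealSpan (Or.inr (Or.inl ⟨(s, x, t), rfl⟩))
  have hD : ∀ r ∈ R, ∀ u v, T (l u) (τ r v) ∈ N := by
    intro r hr u v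
    refine bilin_mem b N (LinearMap.mk₂ K
      (fun u v => T (l u) (τ r v)) ?_ ?_ ?_ ?_) ?_ u v
    · intro v v' w
      simp only [map_add, LinearMap.add_apply]
    · intro c v w
      simp only [map_smul, LinearMap.smul_apply]
    · intro v w w'
      simp only [map_add, τ_add']
    · intro c v w
      simp only [map_smul, τ_smul']
    · intro s t
      exact subset_idealSpan (Or.inr (Or.inr ⟨(s, ⟨r, hr⟩, t), rfl⟩))
  have hD1 : ∀ r ∈ R, ∀ v, τ r v ∈ N := by
    intro r hr v
    have := hD r hr o v
    rwa [hlo, hTone] at this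
  -- stability
  have hst0 : ∀ x, ∀ a ∈ S, T (X x) a ∈ N := by
    rintro x a (⟨⟨⟨t, x', s⟩, p⟩, rfl⟩ | ⟨⟨t, x', s⟩, rfl⟩ | ⟨⟨s, ⟨r, hr⟩, t⟩, rfl⟩)
    · change T (X x) (T (l (b t) * e x' (b s)) (gen K p) - gen K (t, x', s) * gen K p) ∈ N
      rw [map_sub, hTr, ← hyy t x' s, hTX x (yy _ _ _), hT0yy, ← hTmul, ← mul_assoc, hXl, add_mul, hTadd,
        add_mul, add_sub_add_comm]
      refine N.add_mem (hS0 _ _ _ _) ?_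
      rw [hTmul, mul_assoc, ← sub_add_sub_cancel _ (yy x o (b t) * T (e x' (b s)) (gen K p)),
        ← mul_sub]
      exact N.add_mem (hSe _ _ _) (hNl _ _ (hSe _ _ _))
    · change T (X x) (τ (l (b t) * e x' (b s)) o - gen K (t, x', s)) ∈ N
      have h1 : T (X x) (τ (l (b t) * e x' (b s)) o) = τ (X x * (l (b t) * e x' (b s))) o := by
        rw [τ_mul (X x), mul_smul, heJ, smul_zero]
        have : τ (X x) 0 = 0 := by rw [τ_X, map_zero]
        rw [this, zero_add]
      have h2 : τ (e x (b t) * e x' (b s)) o = T (e x (b t)) (τ (e x' (b s)) o) := by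
        rw [τ_mul, heJ]
        have : τ (e x (b t)) 0 = 0 := by
          have := τ_smul' 0 (e x (b t)) 0
          rwa [zero_smul, zero_smul] at this
        rw [this, zero_add]
      rw [map_sub, ← hyy t x' s, hTX x (yy _ _ _), hT0yy, h1, ← mul_assoc, hXl, add_mul, τ_add,
        add_sub_add_comm]
      refine N.add_mem (hC _ _ _) ?_
      rw [h2, ← sub_add_sub_cancel _ (yy x o (b t) * τ (e x' (b s)) o), ← mul_sub]
      refine N.add_mem (hSe _ _ _) (hNl _ _ ?_)
      have := hC x' o (b s)
      rwa [hlo, one_mul] at this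
    · change T (X x) (T (l (b s)) (τ r (b t))) ∈ N
      rw [← hTmul, hXl, hTadd]
      refine N.add_mem (hD r hr _ _) ?_
      rw [← sub_add_cancel (T _ _) (yy x o (b s) * τ r (b t))]
      exact N.add_mem (hSe _ _ _) (hNl _ _ (hD1 r hr _))
  have hstX : ∀ x, ∀ a ∈ N, T (X x) a ∈ N := by
    intro x a ha
    have := idealSpan_le (s := S) (N ⊓ N.comap (T (X x)))
      (fun a ha => ⟨subset_idealSpan ha, hst0 x a ha⟩) ?_ ?_ ha
    · exact this.2
    · rintro a b ⟨hb1, _⟩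
      refine ⟨hNl _ _ hb1, ?_⟩
      change T (X x) (a * b) ∈ N
      rw [hTr]
      exact hNl _ _ hb1
    · rintro a b ⟨hb1, hb2⟩
      refine ⟨hNr _ _ hb1, ?_⟩
      change T (X x) (b * a) ∈ N
      rw [hTr]
      exact hNr _ _ hb2
  have hst : ∀ g, ∀ a ∈ N, T g a ∈ N := by
    intro g
    induction g using FreeAlgebra.induction with
    | grade0 c => intro a ha; rw [hTalg]; exact N.smul_mem _ ha
    | grade1 x => exact hstX x
    | mul g h hg hh => intro a ha; rw [hTmul]; exact hg _ (hh _ ha)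
    | add g h hg hh => intro a ha; rw [hTadd]; exact N.add_mem (hg _ ha) (hh _ ha)
  have τ_zero : ∀ g, τ g 0 = 0 := by
    intro g
    have := τ_smul' 0 g 0
    rwa [zero_smul, zero_smul] at this
  -- elements of the kernel of `f`
  have hTN : ∀ g : G, (∀ v : V, g • v = 0) → (∀ v, τ g v ∈ N) → ∀ q, T g q ∈ N := by
    intro g hg hg' q
    have hgen' : ∀ p, T g (gen K p) ∈ N := by
      rintro ⟨t, x, s⟩
      rw [← hyy, hTyy, hg, map_zero, LinearMap.zero_apply, zero_add]
      exact hNr _ _ (hg' _)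
    induction q using free_induction with
    | zero => simp
    | hgen p => exact hgen' p
    | hmul p q _ => rw [hTr]; exact hNr _ _ (hgen' p)
    | add a b ha hb => rw [map_add]; exact N.add_mem ha hb
    | smul c a ha => rw [map_smul]; exact N.smul_mem _ ha
  have hkerN : ∀ g, f g = 0 → (∀ v : V, g • v = 0) ∧ ∀ v, τ g v ∈ N := by
    intro g hg
    let M : Submodule K G :=
      { carrier := {g | (∀ v : V, g • v = 0) ∧ ∀ v, τ g v ∈ N}
        add_mem' := by
          rintro g h ⟨h1, h2⟩ ⟨h3, h4⟩
          refine ⟨fun v => by rw [add_smul, h1, h3, add_zero], fun v => ?_⟩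
          rw [τ_add]; exact N.add_mem (h2 v) (h4 v)
        zero_mem' := by
          refine ⟨fun v => zero_smul _ v, fun v => ?_⟩
          have := τ_smul 0 0 v
          rw [zero_smul, zero_smul] at this
          rw [this]; exact N.zero_mem
        smul_mem' := by
          rintro c g ⟨h1, h2⟩
          refine ⟨fun v => by rw [smul_assoc, h1, smul_zero], fun v => ?_⟩
          rw [τ_smul]; exact N.smul_mem _ (h2 v) }
    refine idealSpan_le M ?_ ?_ ?_ (hker g hg)
    · intro r hr
      exact ⟨(hJ r).2 ⟨0, by rw [map_zero, hR r hr]⟩, hD1 r hr⟩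
    · rintro a c ⟨h1, h2⟩
      refine ⟨fun v => by rw [mul_smul, h1, smul_zero], fun v => ?_⟩
      rw [τ_mul, h1, τ_zero, zero_add]
      exact hst _ _ (h2 v)
    · rintro a c ⟨h1, h2⟩
      refine ⟨fun v => by rw [mul_smul, h1], fun v => ?_⟩
      rw [τ_mul]
      exact N.add_mem (h2 _) (hTN c h1 h2 _)
  -- lifting
  have hlift : ∀ q : Q, ∃ g : G, (∀ v : V, g • v = 0) ∧ f g = i (π q) ∧ τ g o - q ∈ N := by
    intro q
    induction q using free_induction with
    | zero =>
      have := hkerN 0 (map_zero f)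
      refine ⟨0, this.1, by simp, ?_⟩
      rw [sub_zero]; exact this.2 _
    | hgen p =>
      obtain ⟨t, x, s⟩ := p
      rw [← hyy]
      refine ⟨l (b t) * e x (b s), fun v => by rw [mul_smul, heJ, smul_zero], ?_, hC _ _ _⟩
      rw [hπyy]
    | hmul p q hq =>
      obtain ⟨t, x, s⟩ := p
      obtain ⟨g, hg1, hg2, hg3⟩ := hq
      rw [← hyy]
      refine ⟨l (b t) * e x (b s) * g, fun v => by rw [mul_smul, hg1, smul_zero], ?_, ?_⟩
      · rw [map_mul π, map_mul i, hπyy, map_mul f (l (b t) * e x (b s)) g, hg2]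
      · rw [τ_mul, hg1, τ_zero, zero_add,
          ← sub_add_sub_cancel _ (yy x (b t) (b s) * τ g o), ← mul_sub]
        exact N.add_mem (hSq _ _ _ _) (hNl _ _ hg3)
    | add a c ha hc =>
      obtain ⟨g, hg1, hg2, hg3⟩ := ha
      obtain ⟨h, hh1, hh2, hh3⟩ := hc
      refine ⟨g + h, fun v => by rw [add_smul, hg1, hh1, add_zero], ?_, ?_⟩
      · rw [map_add, map_add, map_add, hg2, hh2]
      · rw [τ_add, add_sub_add_comm]; exact N.add_mem hg3 hh3
    | smul c a ha =>
      obtain ⟨g, hg1, hg2, hg3⟩ := ha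
      refine ⟨c • g, fun v => by rw [smul_assoc, hg1, smul_zero], ?_, ?_⟩
      · rw [map_smul, map_smul, map_smul, hg2]
      · rw [τ_smul, ← smul_sub]; exact N.smul_mem _ hg3
  refine fp_of_finite π ?_ S hSfin fun q => ⟨fun hq => ?_, fun hq => ?_⟩
  · intro a
    obtain ⟨g, hg⟩ := hs a
    exact ⟨τ g o, hi (by rw [hπρ g ((hJ g).2 ⟨a, hg.symm⟩), hg])⟩
  · obtain ⟨g, hg1, hg2, hg3⟩ := hlift q
    rw [hq, map_zero] at hg2
    have := N.sub_mem ((hkerN g hg2).2 o) hg3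
    rwa [sub_sub_cancel] at this
  · refine idealSpan_le (s := S) (LinearMap.ker (π : Q →ₗ[K] I)) ?_ ?_ ?_ hq
    · rintro a (⟨⟨⟨t, x', s⟩, p⟩, rfl⟩ | ⟨⟨t, x', s⟩, rfl⟩ | ⟨⟨s, ⟨r, hr⟩, t⟩, rfl⟩)
      · change π (T (l (b t) * e x' (b s)) (gen K p) - gen K (t, x', s) * gen K p) = 0
        apply hi
        rw [map_sub, map_sub, hπT, ← hyy t x' s, map_mul π, map_mul i, hπyy, sub_self, map_zero]
      · change π (τ (l (b t) * e x' (b s)) o - gen K (t, x', s)) = 0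
        apply hi
        rw [map_sub, map_sub, hπρ _ (fun v => by rw [mul_smul, heJ, smul_zero]), ← hyy t x' s, hπyy,
          sub_self, map_zero]
      · change π (T (l (b s)) (τ r (b t))) = 0
        apply hi
        have h1 := hπτ r (b t)
        rw [map_mul, hR r hr, zero_mul, (hJ r).2 ⟨0, by rw [map_zero, hR r hr]⟩, map_zero,
          map_zero, zero_add] at h1
        rw [hπT, ← h1, mul_zero, map_zero]
    · intro a c hc
      change π c = 0 at hc
      change π (a * c) = 0
      rw [map_mul, hc, mul_zero]
    · intro a c hc
      change π c = 0 at hc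
      change π (c * a) = 0
      rw [map_mul, hc, zero_mul]


set_option maxHeartbeats 1000000 in
lemma fp_ideal {K A I W : Type*} [Field K] [NonUnitalRing A] [Module K A] [IsScalarTower K A A]
    [SMulCommClass K A A] [NonUnitalRing I]
    [Module K I] [IsScalarTower K I I] [SMulCommClass K I I] (hA : NUAlgFP K A)
    (i : I →ₙₐ[K] A) (hi : Function.Injective i)
    (hl : ∀ u a, ∃ a', i a' = u * i a) (hr : ∀ u a, ∃ a', i a' = i a * u)
    [AddCommGroup W] [Module K W] [FiniteDimensional K W] (θ : A →ₗ[K] W)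
    (hθ : ∀ a, θ a = 0 → ∃ c, i c = a) : NUAlgFP K I := by
  classical
  obtain ⟨n, f0, hf0, R0, hR0⟩ := hA
  let f : FreeAlgebra K (Fin n) →ₐ[K] Unitization K A :=
    FreeAlgebra.lift K fun x => (f0 (gen K x) : Unitization K A)
  let j : FreeNUAlg K (Fin n) →ₙₐ[K] FreeAlgebra K (Fin n) := freeLift (FreeAlgebra.ι K)
  have hj : ∀ x, j (gen K x) = FreeAlgebra.ι K x := fun x => freeLift_gen _ x
  have hfX : ∀ x, f (FreeAlgebra.ι K x) = (f0 (gen K x) : Unitization K A) := fun x =>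
    FreeAlgebra.lift_ι_apply _ x
  have hfj : ∀ q, f (j q) = (f0 q : Unitization K A) :=
    freeHom_ext ((f : FreeAlgebra K (Fin n) →ₙₐ[K] Unitization K A).comp j)
      ((Unitization.inrNonUnitalAlgHom K A).comp f0) (by
        intro y
        simp only [NonUnitalAlgHom.comp_apply, hj]
        exact hfX y)
  have hdec : ∀ g, ∃ c q, g = algebraMap K (FreeAlgebra K (Fin n)) c + j q := by
    intro g
    induction g using FreeAlgebra.induction with
    | grade0 c => exact ⟨c, 0, by simp⟩
    | grade1 x => exact ⟨0, gen K x, by simp [hj]⟩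
    | mul g h hg hh =>
      obtain ⟨c, q, rfl⟩ := hg
      obtain ⟨d, p, rfl⟩ := hh
      refine ⟨c * d, c • p + d • q + q * p, ?_⟩
      simp only [map_add, map_smul, map_mul, add_mul, mul_add, ← Algebra.smul_def]
      rw [← Algebra.commutes d (j q), ← Algebra.smul_def]
      abel
    | add g h hg hh =>
      obtain ⟨c, q, rfl⟩ := hg
      obtain ⟨d, p, rfl⟩ := hh
      exact ⟨c + d, q + p, by simp only [map_add]; abel⟩
  have hfdec : ∀ c q, f (algebraMap K (FreeAlgebra K (Fin n)) c + j q)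
      = Unitization.inl c + (f0 q : Unitization K A) := by
    intro c q
    rw [map_add, hfj, AlgHom.commutes]
    rfl
  let i' : I →ₙₐ[K] Unitization K A := (Unitization.inrNonUnitalAlgHom K A).comp i
  have hi'a : ∀ a, i' a = (i a : Unitization K A) := fun a => rfl
  have hi' : Function.Injective i' := Unitization.inr_injective.comp hi
  have hl' : ∀ u a, ∃ a', i' a' = u * i' a := by
    intro u a
    induction u using Unitization.ind with
    | inl_add_inr r u =>
      obtain ⟨a', ha'⟩ := hl u a
      refine ⟨r • a + a', ?_⟩
      rw [add_mul, hi'a, hi'a, map_add, map_smul, ha', Unitization.inl_mul_inr,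
        ← Unitization.inr_mul, Unitization.inr_add]
  have hr' : ∀ u a, ∃ a', i' a' = i' a * u := by
    intro u a
    induction u using Unitization.ind with
    | inl_add_inr r u =>
      obtain ⟨a', ha'⟩ := hr u a
      refine ⟨r • a + a', ?_⟩
      rw [mul_add, hi'a, hi'a, map_add, map_smul, ha', Unitization.inr_mul_inl,
        ← Unitization.inr_mul, Unitization.inr_add]
  let J : Ideal (FreeAlgebra K (Fin n)) :=
    { carrier := {g | ∃ a, i' a = f g}
      add_mem' := by
        rintro g h ⟨a, ha⟩ ⟨b, hb⟩
        exact ⟨a + b, by rw [map_add, map_add, ha, hb]⟩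
      zero_mem' := ⟨0, by rw [map_zero, map_zero]⟩
      smul_mem' := by
        rintro g h ⟨a, ha⟩
        obtain ⟨b, hb⟩ := hl' (f g) a
        exact ⟨b, by rw [hb, ha, smul_eq_mul, map_mul]⟩ }
  have hJr : ∀ g h, g ∈ J → g * h ∈ J := by
    rintro g h ⟨a, ha⟩
    obtain ⟨b, hb⟩ := hr' (f h) a
    exact ⟨b, by rw [hb, ha, map_mul]⟩
  let Θ : FreeAlgebra K (Fin n) →ₗ[K] K × W :=
    LinearMap.prod ((Unitization.fstHom K A).toLinearMap ∘ₗ f.toLinearMap)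
      (θ ∘ₗ (Unitization.sndHom K K A : Unitization K A →ₗ[K] A) ∘ₗ f.toLinearMap)
  have hΘ : ∀ g, Θ g = 0 → g ∈ J := by
    intro g hg
    have h1 : (f g).fst = 0 := congrArg Prod.fst hg
    have h2 : θ (f g).snd = 0 := congrArg Prod.snd hg
    obtain ⟨c, hc⟩ := hθ _ h2
    refine ⟨c, ?_⟩
    rw [hi'a, hc]
    ext
    · simp [h1]
    · simp
  let mk : FreeAlgebra K (Fin n) →ₗ[K] (FreeAlgebra K (Fin n) ⧸ J) := J.mkQ.restrictScalars K
  have hmk : ∀ g, mk g = Submodule.Quotient.mk g := fun g => rfl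
  have hmks : Function.Surjective mk := Submodule.mkQ_surjective J
  have hmk0 : ∀ g, mk g = 0 ↔ g ∈ J := fun g => Submodule.Quotient.mk_eq_zero J
  have hfin : FiniteDimensional K (FreeAlgebra K (Fin n) ⧸ J) := by
    have h1 : FiniteDimensional K (FreeAlgebra K (Fin n) ⧸ LinearMap.ker Θ) :=
      Module.Finite.of_injective _ (LinearMap.ker_eq_bot.1 (Submodule.ker_liftQ_eq_bot _ Θ
        le_rfl le_rfl))
    refine Module.Finite.of_surjective ((LinearMap.ker Θ).liftQ mk ?_) ?_
    · intro g hg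
      exact (hmk0 g).2 (hΘ g hg)
    · intro v
      obtain ⟨g, rfl⟩ := hmks v
      exact ⟨Submodule.Quotient.mk g, Submodule.liftQ_apply _ _ _⟩
  obtain ⟨l0, hl0⟩ := LinearMap.exists_rightInverse_of_surjective mk (LinearMap.range_eq_top.2 hmks)
  have hl0' : ∀ v, mk (l0 v) = v := fun v => DFunLike.congr_fun hl0 v
  have ho0 : mk 1 ≠ 0 := by
    rw [Ne, hmk0]
    rintro ⟨a, ha⟩
    rw [map_one, hi'a] at ha
    have := congrArg (fun z : Unitization K A => z.fst) ha
    simp at this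
  obtain ⟨φ, hφ⟩ : ∃ φ : Module.Dual K (FreeAlgebra K (Fin n) ⧸ J), φ (mk 1) ≠ 0 := by
    by_contra! hcon
    exact ho0 ((Module.forall_dual_apply_eq_zero_iff K _).1 hcon)
  let l : (FreeAlgebra K (Fin n) ⧸ J) →ₗ[K] FreeAlgebra K (Fin n) :=
    l0 + ((φ (mk 1))⁻¹ • φ).smulRight (1 - l0 (mk 1))
  have hla : ∀ v, l v = l0 v + ((φ (mk 1))⁻¹ * φ v) • (1 - l0 (mk 1)) := fun v => rfl
  have hsm : ∀ g, g • mk 1 = mk g := by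
    intro g
    rw [hmk, hmk, ← Submodule.Quotient.mk_smul, smul_eq_mul, mul_one]
  have hJz : ∀ g, g ∈ J → ∀ v : FreeAlgebra K (Fin n) ⧸ J, g • v = 0 := by
    intro g hg v
    obtain ⟨h, rfl⟩ := hmks v
    rw [hmk, ← Submodule.Quotient.mk_smul, Submodule.Quotient.mk_eq_zero]
    exact hJr _ _ hg
  refine fp_ideal_aux f (R0.image j) ?_ ?_ i' hi' ?_ (V := FreeAlgebra K (Fin n) ⧸ J) ?_ (mk 1)
    ?_ l ?_ ?_
  · intro r0 hr0
    obtain ⟨r, hr1, rfl⟩ := Finset.mem_image.1 hr0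
    rw [hfj, (hR0 r).2 (subset_idealSpan (Finset.mem_coe.2 hr1)), Unitization.inr_zero]
  · intro g hg
    obtain ⟨c, q, rfl⟩ := hdec g
    rw [hfdec] at hg
    have h1 : c = 0 := by simpa using congrArg (fun z : Unitization K A => z.fst) hg
    have h2 : f0 q = 0 := by simpa using congrArg (fun z : Unitization K A => z.snd) hg
    rw [h1, map_zero, zero_add]
    refine idealSpan_map j (s := (R0 : Set _)) ?_ ((hR0 q).1 h2)
    intro x hx
    exact subset_idealSpan (Finset.mem_coe.2 (Finset.mem_image_of_mem _ hx))
  · intro a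
    obtain ⟨q, hq⟩ := hf0 (i a)
    exact ⟨j q, by rw [hfj, hq, hi'a]⟩
  · intro g
    constructor
    · intro h
      have := h (mk 1)
      rw [hsm, hmk0] at this
      exact this
    · exact hJz g
  · intro g hg
    rw [hsm, hmk0] at hg
    exact hJz g hg
  · intro v
    have h0 : mk (1 - l0 (mk 1)) = 0 := by rw [map_sub, hl0', sub_self]
    have h1 : ∀ c : K, mk (c • (1 - l0 (mk 1))) = 0 := by
      intro c
      exact (LinearMap.ker mk).smul_mem c h0
    rw [hsm, hla, map_add, h1, hl0', add_zero]
  · rw [hla, inv_mul_cancel₀ hφ, one_smul, add_sub_cancel]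

set_option maxHeartbeats 1000000 in
lemma fp_sub {K A : Type*} [Field K]
    [NonUnitalRing A] [Module K A] [IsScalarTower K A A] [SMulCommClass K A A]
    (B : NonUnitalSubalgebra K A)
    (hB : FiniteDimensional K (A ⧸ B.toSubmodule)) (h : NUAlgFP K A) : NUAlgFP K B := by
  classical
  let b := Module.finBasis K (A ⧸ B.toSubmodule)
  set m := Module.finrank K (A ⧸ B.toSubmodule)
  choose w hw using fun s => Submodule.mkQ_surjective B.toSubmodule (b s)
  have hdec : ∀ a : A, ∃ (c : Fin m → K) (d : A), d ∈ B ∧ a = ∑ s, c s • w s + d := by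
    intro a
    let c := b.repr (B.toSubmodule.mkQ a)
    have h1 : a - ∑ s, c s • w s ∈ B.toSubmodule := by
      rw [← Submodule.ker_mkQ B.toSubmodule, LinearMap.mem_ker, map_sub, map_sum]
      simp only [map_smul, hw]
      rw [b.sum_repr, sub_self]
    exact ⟨c, _, h1, by simp⟩
  let p := B.toSubmodule.mkQ
  have hp : ∀ a, p a = 0 ↔ a ∈ B := fun a => Submodule.Quotient.mk_eq_zero B.toSubmodule
  let θ : A →ₗ[K] (A ⧸ B.toSubmodule) × (Fin m → A ⧸ B.toSubmodule) ×
      (Fin m → A ⧸ B.toSubmodule) × (Fin m × Fin m → A ⧸ B.toSubmodule) :=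
    LinearMap.prod p (LinearMap.prod
      (LinearMap.pi fun s => p ∘ₗ LinearMap.mulLeft K (w s))
      (LinearMap.prod (LinearMap.pi fun s => p ∘ₗ LinearMap.mulRight K (w s))
        (LinearMap.pi fun s => p ∘ₗ LinearMap.mulLeft K (w s.1) ∘ₗ LinearMap.mulRight K (w s.2))))
  let I : NonUnitalSubalgebra K B :=
    { carrier := {x | (∀ c : A, c * x ∈ B) ∧ (∀ c : A, x * c ∈ B) ∧ ∀ c d : A, c * x * d ∈ B}
      add_mem' := by
        rintro x y ⟨h1, h2, h3⟩ ⟨k1, k2, k3⟩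
        refine ⟨fun c => ?_, fun c => ?_, fun c d => ?_⟩
        · simpa [mul_add] using B.add_mem (h1 c) (k1 c)
        · simpa [add_mul] using B.add_mem (h2 c) (k2 c)
        · simpa [add_mul, mul_add] using B.add_mem (h3 c d) (k3 c d)
      zero_mem' := by simp
      smul_mem' := by
        rintro r x ⟨h1, h2, h3⟩
        refine ⟨fun c => ?_, fun c => ?_, fun c d => ?_⟩
        · simpa [mul_smul_comm] using B.toSubmodule.smul_mem r (h1 c)
        · simpa [smul_mul_assoc] using B.toSubmodule.smul_mem r (h2 c)
        · simpa [smul_mul_assoc, mul_smul_comm] using B.toSubmodule.smul_mem r (h3 c d)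
      mul_mem' := by
        rintro x y ⟨h1, h2, h3⟩ ⟨k1, k2, k3⟩
        refine ⟨fun c => ?_, fun c => ?_, fun c d => ?_⟩
        · simpa [mul_assoc] using k1 (c * x)
        · simpa [mul_assoc] using h2 (y * c)
        · simpa [mul_assoc] using k3 (c * x) d }
  have hθ : ∀ a, θ a = 0 → ∃ ha : a ∈ B, (⟨a, ha⟩ : B) ∈ I := by
    intro a ha
    have h0 : a ∈ B := (hp a).1 (congrArg Prod.fst ha)
    have h1 : ∀ s, w s * a ∈ B := fun s =>
      (hp _).1 (congrFun (congrArg (fun z => z.2.1) ha) s)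
    have h2 : ∀ s, a * w s ∈ B := fun s =>
      (hp _).1 (congrFun (congrArg (fun z => z.2.2.1) ha) s)
    have h3 : ∀ s t, w s * (a * w t) ∈ B := fun s t =>
      (hp _).1 (congrFun (congrArg (fun z => z.2.2.2) ha) (s, t))
    have k1 : ∀ c, c * a ∈ B := by
      intro c
      obtain ⟨r, d, hd, rfl⟩ := hdec c
      rw [add_mul, Finset.sum_mul]
      refine B.add_mem (B.toSubmodule.sum_mem fun s _ => ?_) (B.mul_mem hd h0)
      rw [smul_mul_assoc]
      exact B.toSubmodule.smul_mem _ (h1 s)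
    have k2 : ∀ c, a * c ∈ B := by
      intro c
      obtain ⟨r, d, hd, rfl⟩ := hdec c
      rw [mul_add, Finset.mul_sum]
      refine B.add_mem (B.toSubmodule.sum_mem fun s _ => ?_) (B.mul_mem h0 hd)
      rw [mul_smul_comm]
      exact B.toSubmodule.smul_mem _ (h2 s)
    have k3 : ∀ s d, w s * a * d ∈ B := by
      intro s c
      obtain ⟨r, d, hd, rfl⟩ := hdec c
      rw [mul_add, Finset.mul_sum]
      refine B.add_mem (B.toSubmodule.sum_mem fun t _ => ?_) (B.mul_mem (h1 s) hd)
      rw [mul_smul_comm, mul_assoc]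
      exact B.toSubmodule.smul_mem _ (h3 s t)
    refine ⟨h0, k1, k2, fun c d => ?_⟩
    obtain ⟨r, e, he, rfl⟩ := hdec c
    change (_ + e) * a * d ∈ B
    rw [add_mul, add_mul, Finset.sum_mul, Finset.sum_mul, mul_assoc e]
    refine B.add_mem (B.toSubmodule.sum_mem fun t _ => ?_) (B.mul_mem he (k2 d))
    rw [smul_mul_assoc, smul_mul_assoc]
    exact B.toSubmodule.smul_mem _ (k3 t d)
  let i : I →ₙₐ[K] A :=
    (NonUnitalSubalgebraClass.subtype B).comp (NonUnitalSubalgebraClass.subtype I)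
  have hi : Function.Injective i := Subtype.val_injective.comp Subtype.val_injective
  have hia : ∀ a : I, i a = ((a : B) : A) := fun a => rfl
  have hI : NUAlgFP K I := by
    refine fp_ideal h i hi ?_ ?_ θ ?_
    · rintro u ⟨⟨a, ha⟩, h1, h2, h3⟩
      refine ⟨⟨⟨u * a, h1 u⟩, fun c => ?_, fun c => ?_, fun c d => ?_⟩, rfl⟩
      · simpa [mul_assoc] using h1 (c * u)
      · simpa [mul_assoc] using h3 u c
      · simpa [mul_assoc] using h3 (c * u) d
    · rintro u ⟨⟨a, ha⟩, h1, h2, h3⟩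
      refine ⟨⟨⟨a * u, h2 u⟩, fun c => ?_, fun c => ?_, fun c d => ?_⟩, rfl⟩
      · simpa [mul_assoc] using h3 c u
      · simpa [mul_assoc] using h2 (u * c)
      · simpa [mul_assoc] using h3 c (u * d)
    · intro a ha
      obtain ⟨h1, h2⟩ := hθ a ha
      exact ⟨⟨⟨a, h1⟩, h2⟩, rfl⟩
  refine fp_of_sub I ?_ hI
  let Θ := θ ∘ₗ B.toSubmodule.subtype
  have h1 : FiniteDimensional K (B ⧸ LinearMap.ker Θ) :=
    Module.Finite.of_injective _ (LinearMap.ker_eq_bot.1 (Submodule.ker_liftQ_eq_bot _ Θ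
        le_rfl le_rfl))
  have hle : LinearMap.ker Θ ≤ I.toSubmodule := by
    intro x hx
    obtain ⟨_, h⟩ := hθ x hx
    exact h
  exact Module.Finite.of_surjective (Submodule.factor hle) (Submodule.factor_surjective hle)

end FCod

/-- Let `K` be a field, `A` an associative `K`-algebra (not necessarily
commutative or unital) and `B` a `K`-subalgebra of finite codimension (i.e. `A/B` is a
finite-dimensional `K`-vector space). Then `A` is finitely presented as a `K`-algebra if
and only if `B` is. -/
theorem subalgebra_finite_codimension_fp_iff
    (K A : Type*) [Field K]
    [NonUnitalRing A] [Module K A] [IsScalarTower K A A] [SMulCommClass K A A]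
    (B : NonUnitalSubalgebra K A)
    (hB : FiniteDimensional K (A ⧸ B.toSubmodule)) :
    NUAlgFP K A ↔ NUAlgFP K B := by
  exact ⟨FCod.fp_sub B hB, FCod.fp_of_sub B hB⟩
end

section
/- Let K be a commutative ring with identity (not necessarily Noetherian), let A be an associative K-algebra (not necessarily commutative or unital), and let B be a K-subalgebra of A such that the quotient A/B is a finitely presented K-module. Then A is finitely generated as a K-algebra if and only if B is finitely generated as a K-algebra. -/
theorem nuAlgFG_sub_iff {K A : Type*} [CommRing K]
    [NonUnitalRing A] [Module K A] [IsScalarTower K A A] [SMulCommClass K A A]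
    (B : NonUnitalSubalgebra K A) :
    NUAlgFG K B ↔ ∃ s : Finset A, NonUnitalAlgebra.adjoin K (s : Set A) = B := by
  classical
  let f : B →ₙₐ[K] A := NonUnitalSubalgebraClass.subtype B
  have key : ∀ s : Set B, (NonUnitalAlgebra.adjoin K s).map f
      = NonUnitalAlgebra.adjoin K ((fun x : B => (x : A)) '' s) :=
    fun s => NonUnitalAlgHom.map_adjoin K B f s
  have htop : (⊤ : NonUnitalSubalgebra K B).map f = B := by
    ext x
    constructor
    · rintro ⟨y, -, rfl⟩
      exact y.2
    · intro hx
      exact ⟨⟨x, hx⟩, trivial, rfl⟩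
  constructor
  · rintro ⟨s, hs⟩
    refine ⟨s.image (fun x : B => (x : A)), ?_⟩
    rw [Finset.coe_image, ← key, hs, htop]
  · rintro ⟨s, hs⟩
    have hsB : ∀ x ∈ s, x ∈ B := fun x hx => hs ▸ NonUnitalAlgebra.subset_adjoin K hx
    refine ⟨s.subtype (· ∈ B), ?_⟩
    have h1 : (fun x : B => (x : A)) '' (s.subtype (· ∈ B) : Set B) = (s : Set A) := by
      ext x
      constructor
      · rintro ⟨y, hy, rfl⟩
        exact Finset.mem_subtype.1 hy
      · intro hx
        exact ⟨⟨x, hsB x hx⟩, Finset.mem_subtype.2 hx, rfl⟩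
    have h2 := key (s.subtype (· ∈ B) : Set B)
    rw [h1, hs] at h2
    rw [eq_top_iff]
    intro y _
    have : (y : A) ∈ (NonUnitalAlgebra.adjoin K (s.subtype (· ∈ B) : Set B)).map f := by
      rw [h2]; exact y.2
    obtain ⟨z, hz, hzy⟩ := this
    have : z = y := Subtype.ext hzy
    exact this ▸ hz

theorem subalgebra_finitely_presented_quotient_fg_iff
    (K A : Type*) [CommRing K]
    [NonUnitalRing A] [Module K A] [IsScalarTower K A A] [SMulCommClass K A A]
    (B : NonUnitalSubalgebra K A)
    (hB : Module.FinitePresentation K (A ⧸ B.toSubmodule)) :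
    NUAlgFG K A ↔ NUAlgFG K B := by
  classical
  rw [nuAlgFG_sub_iff]
  -- lifts of module generators
  obtain ⟨L, hL⟩ : ∃ L : Finset A, ∀ a : A, ∃ v ∈ Submodule.span K (L : Set A), a - v ∈ B := by
    obtain ⟨q, hq⟩ := (inferInstance : Module.Finite K (A ⧸ B.toSubmodule)).fg_top
    choose g hg using Submodule.mkQ_surjective B.toSubmodule
    refine ⟨q.image g, fun a => ?_⟩
    have h1 : (Submodule.span K ((q.image g : Finset A) : Set A)).map B.toSubmodule.mkQ = ⊤ := by
      rw [Submodule.map_span, Finset.coe_image, ← Set.image_comp, ← hq]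
      congr 1
      have : (B.toSubmodule.mkQ ∘ g : _ → _) = id := funext hg
      rw [this, Set.image_id]
    have h2 : B.toSubmodule.mkQ a ∈
        (Submodule.span K ((q.image g : Finset A) : Set A)).map B.toSubmodule.mkQ := by
      rw [h1]; trivial
    obtain ⟨v, hv, hva⟩ := h2
    exact ⟨v, hv, (Submodule.Quotient.eq B.toSubmodule).1 hva.symm⟩
  constructor
  · rintro ⟨X, hX⟩
    set F : Finset A := X ∪ L with hF
    set V := Submodule.span K (F : Set A) with hV
    have hLV : Submodule.span K (L : Set A) ≤ V := Submodule.span_mono (by simp [hF])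
    have hFV : ∀ x ∈ F, x ∈ V := fun x hx => Submodule.subset_span hx
    have hdec : ∀ a : A, ∃ b ∈ B, a - b ∈ V := by
      intro a
      obtain ⟨v, hv, hb⟩ := hL a
      exact ⟨a - v, hb, by simpa using hLV hv⟩
    choose β hβB hβV using hdec
    -- V ∩ B is finitely generated
    obtain ⟨G, hG⟩ : ∃ G : Finset A, Submodule.span K (G : Set A) = V ⊓ B.toSubmodule := by
      have : Module.Finite K V := Module.Finite.iff_fg.2 ⟨F, rfl⟩
      have hs : Function.Surjective (B.toSubmodule.mkQ ∘ₗ V.subtype) := by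
        intro y
        obtain ⟨a, rfl⟩ := Submodule.mkQ_surjective B.toSubmodule y
        refine ⟨⟨a - β a, hβV a⟩, ?_⟩
        refine (Submodule.Quotient.eq B.toSubmodule).2 ?_
        change a - β a - a ∈ B
        have : a - β a - a = -(β a) := by abel
        rw [this]
        exact neg_mem (hβB a)
      have := (Module.FinitePresentation.fg_ker _ hs).map V.subtype
      rw [LinearMap.ker_comp, Submodule.ker_mkQ, Submodule.map_comap_subtype] at this
      exact this
    set S1 : Finset A := (F ×ˢ F).image (fun p => β (p.1 * p.2)) with hS1
    set S2 : Finset A := S1 ∪ (S1 ×ˢ F).image (fun p => β (p.1 * p.2)) ∪ G with hS2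
    set C := NonUnitalAlgebra.adjoin K (S1 : Set A) with hC
    set D := NonUnitalAlgebra.adjoin K (S2 : Set A) with hD
    have hCD : C ≤ D := NonUnitalAlgebra.adjoin_mono (by
      intro x hx; simp only [hS2, Finset.coe_union]; exact Or.inl (Or.inl hx))
    have hS2D : ∀ x ∈ S2, x ∈ D := fun x hx => NonUnitalAlgebra.subset_adjoin K hx
    have hDB : D ≤ B := by
      refine NonUnitalAlgebra.adjoin_le ?_
      intro x hx
      simp only [hS2, Finset.coe_union] at hx
      rcases hx with (hx | hx) | hx
      · obtain ⟨p, -, rfl⟩ := Finset.mem_image.1 (Finset.mem_coe.1 hx)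
        exact hβB _
      · obtain ⟨p, -, rfl⟩ := Finset.mem_image.1 (Finset.mem_coe.1 hx)
        exact hβB _
      · have : x ∈ V ⊓ B.toSubmodule := hG ▸ Submodule.subset_span hx
        exact this.2
    have hGD : V ⊓ B.toSubmodule ≤ D.toSubmodule := by
      rw [← hG, Submodule.span_le]
      intro x hx
      exact hS2D x (Finset.mem_union_right _ hx)
    set N := D.toSubmodule ⊔ V with hN
    have hDN : ∀ x ∈ D, x ∈ N := fun x hx => (le_sup_left : D.toSubmodule ≤ N) hx
    have hVN : V ≤ N := le_sup_right
    -- C V ⊆ D + V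
    have hCV : ∀ t ∈ C, ∀ v ∈ V, t * v ∈ N := by
      intro t ht
      induction ht using NonUnitalAlgebra.adjoin_induction with
      | mem x hx =>
        intro v hv
        induction hv using Submodule.span_induction with
        | mem y hy =>
          have e : x * y = β (x * y) + (x * y - β (x * y)) := by abel
          rw [e]
          refine add_mem (hDN _ (hS2D _ ?_)) (hVN (hβV _))
          refine Finset.mem_union_left _ (Finset.mem_union_right _ ?_)
          exact Finset.mem_image.2 ⟨(x, y), Finset.mem_product.2 ⟨hx, hy⟩, rfl⟩
        | zero => rw [mul_zero]; exact zero_mem _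
        | add y z _ _ h1 h2 => rw [mul_add]; exact add_mem h1 h2
        | smul c y _ h => rw [mul_smul_comm]; exact N.smul_mem c h
      | add x y _ _ h1 h2 => intro v hv; rw [add_mul]; exact add_mem (h1 v hv) (h2 v hv)
      | zero => intro v hv; rw [zero_mul]; exact zero_mem _
      | mul x y hx hy h1 h2 =>
        intro v hv
        rw [mul_assoc]
        obtain ⟨d, hd, w, hw, e⟩ := Submodule.mem_sup.1 (h2 v hv)
        rw [← e, mul_add]
        exact add_mem (hDN _ (mul_mem (hCD hx) hd)) (h1 w hw)
      | smul c x _ h => intro v hv; rw [smul_mul_assoc]; exact N.smul_mem c (h v hv)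
    set M := Submodule.span K ((F : Set A) ∪ (C : Set A) ∪ {a | ∃ c ∈ C, ∃ v ∈ V, a = c * v})
      with hM
    have hMF : V ≤ M := Submodule.span_mono fun x hx => Or.inl (Or.inl hx)
    have hMC : ∀ x ∈ C, x ∈ M := fun x hx => Submodule.subset_span (Or.inl (Or.inr hx))
    have hMCV : ∀ c ∈ C, ∀ v ∈ V, c * v ∈ M := fun c hc v hv =>
      Submodule.subset_span (Or.inr ⟨c, hc, v, hv, rfl⟩)
    have hVF : ∀ v ∈ V, ∀ x ∈ F, ∃ c ∈ C, ∃ w ∈ V, v * x = c + w := by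
      intro v hv x hx
      induction hv using Submodule.span_induction with
      | mem y hy =>
        refine ⟨β (y * x), NonUnitalAlgebra.subset_adjoin K ?_, _, hβV (y * x), by abel⟩
        exact Finset.mem_coe.2
          (Finset.mem_image.2 ⟨(y, x), Finset.mem_product.2 ⟨hy, hx⟩, rfl⟩)
      | zero => exact ⟨0, zero_mem _, 0, zero_mem _, by simp⟩
      | add y z _ _ h1 h2 =>
        obtain ⟨c, hc, w, hw, e⟩ := h1
        obtain ⟨c', hc', w', hw', e'⟩ := h2
        exact ⟨c + c', add_mem hc hc', w + w', add_mem hw hw', by rw [add_mul, e, e']; abel⟩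
      | smul k y _ h =>
        obtain ⟨c, hc, w, hw, e⟩ := h
        exact ⟨k • c, C.smul_mem k hc, k • w, V.smul_mem k hw, by
          rw [smul_mul_assoc, e, smul_add]⟩
    have hMx : ∀ m ∈ M, ∀ x ∈ F, m * x ∈ M := by
      intro m hm x hx
      induction hm using Submodule.span_induction with
      | mem y hy =>
        rcases hy with (hy | hy) | ⟨c, hc, v, hv, rfl⟩
        · obtain ⟨c, hc, w, hw, e⟩ := hVF y (hFV y hy) x hx
          rw [e]; exact add_mem (hMC c hc) (hMF hw)
        · exact hMCV y hy x (hFV x hx)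
        · obtain ⟨c', hc', w, hw, e⟩ := hVF v hv x hx
          rw [mul_assoc, e, mul_add]
          exact add_mem (hMC _ (mul_mem hc hc')) (hMCV c hc w hw)
      | zero => rw [zero_mul]; exact zero_mem _
      | add y z _ _ h1 h2 => rw [add_mul]; exact add_mem h1 h2
      | smul k y _ h => rw [smul_mul_assoc]; exact M.smul_mem k h
    have hMA : ∀ a : A, ∀ m ∈ M, m * a ∈ M := by
      intro a
      have ha : a ∈ NonUnitalAlgebra.adjoin K (X : Set A) := by rw [hX]; trivial
      induction ha using NonUnitalAlgebra.adjoin_induction with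
      | mem x hx => exact fun m hm => hMx m hm x (Finset.mem_union_left _ hx)
      | add x y _ _ h1 h2 => intro m hm; rw [mul_add]; exact add_mem (h1 m hm) (h2 m hm)
      | zero => intro m hm; rw [mul_zero]; exact zero_mem _
      | mul x y _ _ h1 h2 => intro m hm; rw [← mul_assoc]; exact h2 _ (h1 m hm)
      | smul c x _ h => intro m hm; rw [mul_smul_comm]; exact M.smul_mem c (h m hm)
    have hall : ∀ a : A, a ∈ M := by
      intro a
      have ha : a ∈ NonUnitalAlgebra.adjoin K (X : Set A) := by rw [hX]; trivial
      induction ha using NonUnitalAlgebra.adjoin_induction with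
      | mem x hx => exact hMF (hFV x (Finset.mem_union_left _ hx))
      | add x y _ _ h1 h2 => exact add_mem h1 h2
      | zero => exact zero_mem _
      | mul x y _ _ h1 h2 => exact hMA y x h1
      | smul c x _ h => exact M.smul_mem c h
    have hMN : M ≤ N := by
      rw [hM, Submodule.span_le]
      rintro y ((hy | hy) | ⟨c, hc, v, hv, rfl⟩)
      · exact hVN (hFV y hy)
      · exact hDN y (hCD hy)
      · exact hCV c hc v hv
    refine ⟨S2, le_antisymm hDB ?_⟩
    intro b hb
    obtain ⟨d, hd, w, hw, e⟩ := Submodule.mem_sup.1 (hMN (hall b))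
    have hwB : w ∈ B := by
      have : w = b - d := by rw [← e]; abel
      rw [this]; exact sub_mem hb (hDB hd)
    rw [← e]
    exact add_mem (S := NonUnitalSubalgebra K A) hd (hGD ⟨hw, hwB⟩)
  · rintro ⟨s, hs⟩
    refine ⟨s ∪ L, ?_⟩
    rw [eq_top_iff]
    intro a _
    obtain ⟨v, hv, hb⟩ := hL a
    set E := NonUnitalAlgebra.adjoin K ((s ∪ L : Finset A) : Set A) with hE
    have h1 : B ≤ E := by
      rw [← hs]
      exact NonUnitalAlgebra.adjoin_mono (by simp)
    have h2 : Submodule.span K (L : Set A) ≤ E.toSubmodule := by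
      rw [Submodule.span_le]
      intro x hx
      exact NonUnitalAlgebra.subset_adjoin K (Finset.mem_coe.2 (Finset.mem_union_right _ hx))
    have := add_mem (h1 hb) (show v ∈ E from h2 hv)
    simpa using this
end

section
/- Let K be a commutative Noetherian ring with identity, let K⟨X⟩ be the free K-algebra on a finite set X, and let R be a right ideal of K⟨X⟩ such that the quotient K-module K⟨X⟩/R is finitely generated. Then R is finitely presented as a K-algebra. -/
namespace RightIdealFP

section ideal

variable {K : Type*} {A : Type*} [CommRing K] [NonUnitalRing A] [Module K A]

lemma subset_idealSpan (s : Set A) {x : A} (hx : x ∈ s) : x ∈ idealSpan K s := by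
  unfold idealSpan
  rw [Submodule.mem_sInf]
  intro J hJ
  exact hJ.1 hx

lemma idealSpan_mul (s : Set A) {x : A} (hx : x ∈ idealSpan K s) (a : A) :
    a * x ∈ idealSpan K s ∧ x * a ∈ idealSpan K s := by
  unfold idealSpan at *
  rw [Submodule.mem_sInf] at *
  rw [Submodule.mem_sInf]
  exact ⟨fun J hJ => (hJ.2 a x (hx J hJ)).1, fun J hJ => (hJ.2 a x (hx J hJ)).2⟩

lemma idealSpan_le (s : Set A) (J : Submodule K A) (h1 : s ⊆ J)
    (h2 : ∀ a b : A, b ∈ J → a * b ∈ J ∧ b * a ∈ J) : idealSpan K s ≤ J :=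
  sInf_le ⟨h1, h2⟩

end ideal

/-- Generators of the free algebra. -/
noncomputable def gen (K : Type*) {Y : Type*} [CommRing K] (y : Y) : FreeNUAlg K Y :=
  MonoidAlgebra.single (FreeSemigroup.of y) 1

/-- Abstract criterion for finite presentation. -/
lemma fp_criterion {K B : Type*} [CommRing K] [NonUnitalRing B] [Module K B]
    [IsScalarTower K B B] [SMulCommClass K B B] (k : ℕ) (f : FreeNUAlg K (Fin k) →ₙₐ[K] B)
    (M : Submodule K (FreeNUAlg K (Fin k))) (s : Finset (FreeNUAlg K (Fin k)))
    (hs : ∀ x ∈ s, f x = 0) (hgen : ∀ i, gen K i ∈ M)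
    (hmul : ∀ m ∈ M, ∀ i, m * gen K i ∈ M ⊔ idealSpan K (s : Set (FreeNUAlg K (Fin k))))
    (hsurj : Function.Surjective f)
    (hker : ∀ m ∈ M, f m = 0 → m ∈ idealSpan K (s : Set (FreeNUAlg K (Fin k)))) :
    NUAlgFP K B := by
  set I := idealSpan K (s : Set (FreeNUAlg K (Fin k))) with hI
  have hIker : ∀ x ∈ I, f x = 0 := by
    have : I ≤ LinearMap.ker (f : FreeNUAlg K (Fin k) →ₗ[K] B) := by
      apply idealSpan_le
      · intro x hx
        exact hs x hx
      · intro a b hb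
        have hb' : f b = 0 := hb
        constructor
        · change f (a * b) = 0
          rw [map_mul, hb', mul_zero]
        · change f (b * a) = 0
          rw [map_mul, hb', zero_mul]
    exact fun x hx => this hx
  have hmul' : ∀ m ∈ M ⊔ I, ∀ i, m * gen K i ∈ M ⊔ I := by
    intro m hm i
    obtain ⟨a, ha, b, hb, rfl⟩ := Submodule.mem_sup.1 hm
    rw [add_mul]
    exact add_mem (hmul a ha i) (Submodule.mem_sup_right (idealSpan_mul _ hb _).2)
  have hword : ∀ w : FreeSemigroup (Fin k), ∀ m ∈ M ⊔ I,
      m * MonoidAlgebra.single w (1 : K) ∈ M ⊔ I := by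
    intro w
    induction w using FreeSemigroup.recOnMul with
    | ih1 x => exact fun m hm => hmul' m hm x
    | ih2 x y hx hy =>
      intro m hm
      have := hy _ (hmul' m hm x)
      rwa [mul_assoc, gen, MonoidAlgebra.single_mul_single, one_mul] at this
  have htop : ∀ x, x ∈ M ⊔ I := by
    intro x
    induction x using MonoidAlgebra.induction_linear with
    | zero => exact zero_mem _
    | add a b ha hb => exact add_mem ha hb
    | single w r =>
      have : MonoidAlgebra.single w (1 : K) ∈ M ⊔ I := by
        induction w using FreeSemigroup.recOnMul with
        | ih1 x => exact Submodule.mem_sup_left (hgen x)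
        | ih2 x y hx hy =>
          have := hword y _ hx
          rwa [MonoidAlgebra.single_mul_single, one_mul] at this
      have h2 := Submodule.smul_mem _ r this
      rwa [MonoidAlgebra.smul_single', mul_one] at h2
  refine ⟨k, f, hsurj, s, fun x => ⟨fun hx => ?_, hIker x⟩⟩
  obtain ⟨a, ha, b, hb, rfl⟩ := Submodule.mem_sup.1 (htop x)
  rw [map_add, hIker b hb, add_zero] at hx
  exact add_mem (hker a ha hx) hb

section words

variable {K X : Type*} [CommRing K]

/-- Unital free algebra. -/
abbrev UA (K X : Type*) [CommRing K] : Type _ := MonoidAlgebra K (FreeMonoid X)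

/-- Words. -/
noncomputable def wd (K : Type*) {X : Type*} [CommRing K] (l : List X) : UA K X :=
  MonoidAlgebra.single (FreeMonoid.ofList l) 1

lemma wd_mul (a b : List X) : wd K a * wd K b = wd K (a ++ b) := by
  unfold wd
  rw [MonoidAlgebra.single_mul_single, one_mul]
  rfl

lemma wd_nil : wd K ([] : List X) = 1 := rfl

/-- Linear extension. -/
noncomputable def lin {M : Type*} [AddCommGroup M] [Module K M] (g : List X → M) :
    UA K X →ₗ[K] M :=
  (Finsupp.linearCombination K (fun l : FreeMonoid X => g l.toList)) ∘ₗ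
    (MonoidAlgebra.coeffLinearEquiv K : UA K X ≃ₗ[K] _).toLinearMap

lemma lin_wd {M : Type*} [AddCommGroup M] [Module K M] (g : List X → M) (l : List X) :
    lin g (wd K l) = g l := by
  simp [lin, wd]

lemma lin_apply {M : Type*} [AddCommGroup M] [Module K M] (g : List X → M) (a : UA K X) :
    lin g a = a.coeff.sum (fun l c => c • g l.toList) := by
  simp [lin, Finsupp.linearCombination_apply]

lemma wd_induction {p : UA K X → Prop} (a : UA K X) (h0 : p 0)
    (hadd : ∀ a b, p a → p b → p (a + b)) (hsm : ∀ (c : K) a, p a → p (c • a))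
    (hw : ∀ l, p (wd K l)) : p a := by
  induction a using MonoidAlgebra.induction_linear with
  | zero => exact h0
  | add a b ha hb => exact hadd a b ha hb
  | single w r =>
    have := hsm r _ (hw w.toList)
    rwa [wd, MonoidAlgebra.smul_single', mul_one] at this

lemma lin_ext {M : Type*} [AddCommGroup M] [Module K M] {f g : UA K X →ₗ[K] M}
    (h : ∀ l, f (wd K l) = g (wd K l)) : f = g := by
  refine LinearMap.ext fun a => ?_
  induction a using wd_induction with
  | h0 => simp
  | hadd a b ha hb => simp [ha, hb]
  | hsm c a ha => simp [ha]
  | hw l => exact h l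

/-- Elements supported on words of length less than n. -/
noncomputable def deg (K X : Type*) [CommRing K] (n : ℕ) : Submodule K (UA K X) :=
  Submodule.span K (wd K '' {l : List X | l.length < n})

lemma wd_mem_deg {n : ℕ} {l : List X} (h : l.length < n) : wd K l ∈ deg K X n :=
  Submodule.subset_span ⟨l, h, rfl⟩

lemma deg_mono {m n : ℕ} (h : m ≤ n) : deg K X m ≤ deg K X n :=
  Submodule.span_mono (Set.image_mono fun _ hl => lt_of_lt_of_le hl h)

lemma deg_le_iff {n : ℕ} {J : Submodule K (UA K X)} :
    deg K X n ≤ J ↔ ∀ l : List X, l.length < n → wd K l ∈ J := by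
  unfold deg
  rw [Submodule.span_le]
  constructor
  · exact fun h l hl => h ⟨l, hl, rfl⟩
  · rintro h _ ⟨l, hl, rfl⟩
    exact h l hl

lemma deg_induction {n : ℕ} {J : Submodule K (UA K X)} (h : ∀ l : List X, l.length < n → wd K l ∈ J)
    {a : UA K X} (ha : a ∈ deg K X n) : a ∈ J := deg_le_iff.2 h ha

lemma deg_mul {m n k : ℕ} (h : m + n ≤ k + 1) {a b : UA K X} (ha : a ∈ deg K X m)
    (hb : b ∈ deg K X n) : a * b ∈ deg K X k := by
  have h1 : ∀ l : List X, l.length < m → ∀ b ∈ deg K X n, wd K l * b ∈ deg K X k := by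
    intro l hl b hb
    refine deg_induction (J := (deg K X k).comap (LinearMap.mulLeft K (wd K l))) ?_ hb
    intro l' hl'
    change wd K l * wd K l' ∈ deg K X k
    rw [wd_mul]
    apply wd_mem_deg
    rw [List.length_append]
    omega
  refine deg_induction (J := (deg K X k).comap (LinearMap.mulRight K b)) ?_ ha
  exact fun l hl => h1 l hl b hb

lemma coeff_deg {n : ℕ} {a : UA K X} (ha : a ∈ deg K X n) (l : List X) (hl : n ≤ l.length) :
    a.coeff (FreeMonoid.ofList l) = 0 := by
  classical
  refine deg_induction (J := LinearMap.ker ((Finsupp.lapply (FreeMonoid.ofList l)) ∘ₗ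
    (MonoidAlgebra.coeffLinearEquiv K : UA K X ≃ₗ[K] _).toLinearMap)) ?_ ha
  intro l' hl'
  have : FreeMonoid.ofList l ≠ FreeMonoid.ofList l' := by
    intro h
    have := FreeMonoid.ofList.injective h
    subst this
    omega
  simp [wd, this.symm]

lemma mem_deg_of_coeff {n : ℕ} {a : UA K X}
    (h : ∀ l ∈ a.coeff.support, FreeMonoid.length l < n) : a ∈ deg K X n := by
  rw [← MonoidAlgebra.sum_coeff_single a]
  refine Submodule.sum_mem _ fun l hl => ?_
  have := Submodule.smul_mem _ (a.coeff l) (wd_mem_deg (K := K) (l := l.toList) (h l hl))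
  rwa [wd, MonoidAlgebra.smul_single', mul_one] at this

/-- Unitriangular linear maps are injective. -/
lemma lin_inj (g : List X → UA K X) (hg : ∀ l, g l - wd K l ∈ deg K X l.length) (a : UA K X)
    (h : lin g a = 0) : a = 0 := by
  classical
  by_contra hne
  have hsupp : a.coeff.support.Nonempty := by
    rw [Finsupp.support_nonempty_iff]
    simpa using hne
  obtain ⟨l, hl, hmax⟩ := Finset.exists_max_image a.coeff.support FreeMonoid.length hsupp
  have h1 : (lin g a).coeff l = a.coeff l := by
    rw [lin_apply, Finsupp.sum, MonoidAlgebra.coeff_sum, Finset.sum_apply']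
    have key : ∀ l' ∈ a.coeff.support, (a.coeff l' • g l'.toList).coeff l
        = if l' = l then a.coeff l' else 0 := by
      intro l' hl'
      have h2 := coeff_deg (hg l'.toList) l.toList (hmax l' hl')
      have h3 : (g l'.toList).coeff l = if l' = l then 1 else 0 := by
        rw [MonoidAlgebra.coeff_sub, Finsupp.sub_apply, sub_eq_zero] at h2
        simpa [wd, Finsupp.single_apply] using h2
      rw [MonoidAlgebra.coeff_smul, Finsupp.smul_apply, h3]
      simp
    rw [Finset.sum_congr rfl key, Finset.sum_ite_eq']
    simp [hl]
  rw [h] at h1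
  exact (Finsupp.mem_support_iff.1 hl) (by simpa using h1.symm)

lemma deg_finite [Finite X] (n : ℕ) : (wd K '' {l : List X | l.length < n}).Finite :=
  (List.finite_length_lt X n).image _

end words

section normalforms

variable {K X : Type*} [CommRing K] {F : Type*} [NonUnitalRing F] [Module K F]
  [IsScalarTower K F F] [SMulCommClass K F F]

/-- Triangular basis of the unital free algebra. -/
noncomputable def Phi (N : ℕ) (r : List X → UA K X) (l : List X) : UA K X :=
  if l.length < N + 1 then wd K l else r (l.take (N + 1)) * Phi N r (l.drop (N + 1))
termination_by l.length
decreasing_by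
  rw [List.length_drop]
  omega

/-- Normal forms. -/
def Psi (N : ℕ) (y : List X → F) (l : List X) : F :=
  if l.length < N + 1 then 0
  else if l.length < 2 * (N + 1) then y l
  else y (l.take (N + 1)) * Psi N y (l.drop (N + 1))
termination_by l.length
decreasing_by
  rw [List.length_drop]
  omega

variable {N : ℕ} {r : List X → UA K X} {y : List X → F}

lemma Phi_short {l : List X} (h : l.length < N + 1) : Phi N r l = wd K l := by
  rw [Phi, if_pos h]

lemma Phi_long {l : List X} (h : ¬ l.length < N + 1) :
    Phi N r l = r (l.take (N + 1)) * Phi N r (l.drop (N + 1)) := by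
  rw [Phi, if_neg h]

lemma Psi_short {l : List X} (h : l.length < N + 1) : Psi N y l = 0 := by
  rw [Psi, if_pos h]

lemma Psi_mid {l : List X} (h : ¬ l.length < N + 1) (h2 : l.length < 2 * (N + 1)) :
    Psi N y l = y l := by
  rw [Psi, if_neg h, if_pos h2]

lemma Psi_long {l : List X} (h2 : ¬ l.length < 2 * (N + 1)) :
    Psi N y l = y (l.take (N + 1)) * Psi N y (l.drop (N + 1)) := by
  rw [Psi, if_neg (by omega), if_neg h2]

lemma list_strong {p : List X → Prop} (h : ∀ l, (∀ l' : List X, l'.length < l.length → p l') → p l)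
    (l : List X) : p l := by
  induction hn : l.length using Nat.strong_induction_on generalizing l with
  | _ n ih =>
    subst hn
    exact h l fun l' hl' => ih _ hl' l' rfl

lemma Phi_sub (hr : ∀ l : List X, l.length = N + 1 → r l - wd K l ∈ deg K X (N + 1))
    (l : List X) : Phi N r l - wd K l ∈ deg K X l.length := by
  induction l using list_strong with
  | _ l ih =>
  by_cases hl : l.length < N + 1
  · rw [Phi_short hl, sub_self]
    exact zero_mem _
  · rw [Phi_long hl]
    set w := l.take (N + 1) with hw
    set u := l.drop (N + 1) with hu
    have hwl : w.length = N + 1 := by rw [hw, List.length_take]; omega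
    have hul : u.length + (N + 1) = l.length := by rw [hu, List.length_drop]; omega
    have hwu : wd K l = wd K w * wd K u := by rw [wd_mul, List.take_append_drop]
    have h1 := ih u (by omega)
    have h2 : Phi N r u ∈ deg K X (u.length + 1) := by
      have := add_mem (deg_mono (Nat.le_succ _) h1) (wd_mem_deg (K := K) (Nat.lt_succ_self u.length))
      simpa using this
    have : r w * Phi N r u - wd K l
        = wd K w * (Phi N r u - wd K u) + (r w - wd K w) * Phi N r u := by
      rw [hwu]
      noncomm_ring
    rw [this]
    refine add_mem (deg_mul (m := N + 2) (n := u.length) (by omega) (wd_mem_deg (by omega)) h1)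
      (deg_mul (m := N + 1) (n := u.length + 1) (by omega) (hr w hwl) h2)

lemma Psi_append {w l : List X} (hw : w.length = N + 1) (hl : ¬ l.length < N + 1) :
    Psi N y (w ++ l) = y w * Psi N y l := by
  rw [Psi_long (by rw [List.length_append]; omega)]
  rw [List.take_left' hw, List.drop_left' hw]

lemma y_mul_Psi {w : List X} (hw : w.length = N + 1) (m : UA K X) :
    ∃ m' : UA K X, y w * lin (Psi N y) m = lin (Psi N y) m' := by
  induction m using wd_induction with
  | h0 => exact ⟨0, by simp⟩
  | hadd a b ha hb =>
    obtain ⟨a', ha'⟩ := ha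
    obtain ⟨b', hb'⟩ := hb
    exact ⟨a' + b', by rw [map_add, mul_add, ha', hb', map_add]⟩
  | hsm c a ha =>
    obtain ⟨a', ha'⟩ := ha
    exact ⟨c • a', by rw [map_smul, mul_smul_comm, ha', map_smul]⟩
  | hw l =>
    by_cases hl : l.length < N + 1
    · exact ⟨0, by rw [lin_wd, Psi_short hl, mul_zero, map_zero]⟩
    · exact ⟨wd K (w ++ l), by rw [lin_wd, lin_wd, Psi_append hw hl]⟩

variable {g : F →ₙₐ[K] UA K X}

lemma g_Psi (hg : ∀ l : List X, ¬ l.length < N + 1 → l.length < 2 * (N + 1) →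
      g (y l) = r (l.take (N + 1)) * wd K (l.drop (N + 1)))
    (l : List X) (hl : ¬ l.length < N + 1) : g (Psi N y l) = Phi N r l := by
  induction l using list_strong with
  | _ l ih =>
  rw [Phi_long hl]
  by_cases h2 : l.length < 2 * (N + 1)
  · rw [Psi_mid hl h2, hg l hl h2, Phi_short]
    rw [List.length_drop]
    omega
  · have hwl : (l.take (N + 1)).length = N + 1 := by rw [List.length_take]; omega
    have hul : (l.drop (N + 1)).length + (N + 1) = l.length := by rw [List.length_drop]; omega
    rw [Psi_long h2, map_mul, hg _ (by omega) (by omega), ih _ (by omega) (by omega)]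
    rw [List.take_take, List.drop_take]
    simp [wd_nil]

lemma decomp (hr : ∀ l : List X, l.length = N + 1 → r l - wd K l ∈ deg K X (N + 1))
    (hg : ∀ l : List X, ¬ l.length < N + 1 → l.length < 2 * (N + 1) →
      g (y l) = r (l.take (N + 1)) * wd K (l.drop (N + 1))) (a : UA K X) :
    ∃ v ∈ deg K X (N + 1), ∃ m : UA K X, a = v + g (lin (Psi N y) m) := by
  set Q : Submodule K (UA K X) := deg K X (N + 1) ⊔
    LinearMap.range ((g : F →ₗ[K] UA K X) ∘ₗ lin (Psi N y)) with hQ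
  have hword : ∀ l : List X, wd K l ∈ Q := by
    intro l
    induction l using list_strong with
    | _ l ih =>
    by_cases hl : l.length < N + 1
    · exact Submodule.mem_sup_left (wd_mem_deg hl)
    · have h1 : Phi N r l ∈ Q := by
        refine Submodule.mem_sup_right ⟨wd K l, ?_⟩
        change g (lin (Psi N y) (wd K l)) = _
        rw [lin_wd, g_Psi hg l hl]
      have h2 : Phi N r l - wd K l ∈ Q := deg_induction ih (Phi_sub hr l)
      have := sub_mem h1 h2
      simpa using this
  have ha : a ∈ Q := by
    induction a using wd_induction with
    | h0 => exact zero_mem _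
    | hadd a b ha hb => exact add_mem ha hb
    | hsm c a ha => exact Submodule.smul_mem _ c ha
    | hw l => exact hword l
  obtain ⟨v, hv, b, ⟨m, rfl⟩, rfl⟩ := Submodule.mem_sup.1 ha
  exact ⟨v, hv, m, rfl⟩

lemma r_mul (hr : ∀ l : List X, l.length = N + 1 → r l - wd K l ∈ deg K X (N + 1))
    (hg : ∀ l : List X, ¬ l.length < N + 1 → l.length < 2 * (N + 1) →
      g (y l) = r (l.take (N + 1)) * wd K (l.drop (N + 1)))
    (w : List X) (hw : w.length = N + 1) (a : UA K X) :
    ∃ m : UA K X, r w * a = g (lin (Psi N y) m) := by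
  obtain ⟨v, hv, m, rfl⟩ := decomp hr hg a
  have h1 : r w * v ∈ LinearMap.range ((g : F →ₗ[K] UA K X) ∘ₗ lin (Psi N y)) := by
    refine deg_induction (J := (LinearMap.range ((g : F →ₗ[K] UA K X) ∘ₗ lin (Psi N y))).comap
      (LinearMap.mulLeft K (r w))) ?_ hv
    intro l hl
    refine ⟨wd K (w ++ l), ?_⟩
    change g (lin (Psi N y) (wd K (w ++ l))) = r w * wd K l
    rw [lin_wd, Psi_mid, hg, List.take_left' hw, List.drop_left' hw] <;>
      rw [List.length_append] <;> omega
  obtain ⟨m1, hm1⟩ := h1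
  obtain ⟨m2, hm2⟩ := y_mul_Psi (y := y) hw m
  have hgw : g (y w) = r w := by
    rw [hg w (by omega) (by omega), List.take_of_length_le (by omega),
      List.drop_of_length_le (by omega), wd_nil, mul_one]
  refine ⟨m1 + m2, ?_⟩
  rw [map_add, map_add, mul_add, ← hm2, map_mul, hgw, ← hm1]
  rfl

/-- Injectivity on normal forms. -/
lemma normal_inj (hr : ∀ l : List X, l.length = N + 1 → r l - wd K l ∈ deg K X (N + 1))
    (hg : ∀ l : List X, ¬ l.length < N + 1 → l.length < 2 * (N + 1) →
      g (y l) = r (l.take (N + 1)) * wd K (l.drop (N + 1)))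
    (v : UA K X) (hv : v ∈ deg K X (N + 1)) (m : UA K X)
    (h : v + g (lin (Psi N y) m) = 0) : v = 0 ∧ lin (Psi N y) m = 0 := by
  set T : UA K X →ₗ[K] UA K X := lin (fun l => if l.length < N + 1 then 0 else wd K l) with hT
  have hT1 : (lin (Psi N y)) ∘ₗ T = lin (Psi N y) := by
    apply lin_ext
    intro l
    rw [LinearMap.comp_apply, hT, lin_wd, lin_wd]
    split_ifs with hl
    · rw [map_zero, Psi_short hl]
    · rw [lin_wd]
  have hT2 : (g : F →ₗ[K] UA K X) ∘ₗ lin (Psi N y) = lin (Phi N r) ∘ₗ T := by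
    apply lin_ext
    intro l
    rw [LinearMap.comp_apply, LinearMap.comp_apply, hT, lin_wd, lin_wd]
    split_ifs with hl
    · rw [map_zero, Psi_short hl, map_zero]
    · rw [lin_wd]
      exact g_Psi hg l hl
  have hT3 : T ∘ₗ T = T := by
    apply lin_ext
    intro l
    rw [LinearMap.comp_apply, hT, lin_wd]
    split_ifs with hl
    · rw [map_zero]
    · rw [lin_wd, if_neg hl]
  have hTv : T v = 0 := by
    refine deg_induction (J := LinearMap.ker T) ?_ hv
    intro l hl
    rw [LinearMap.mem_ker, hT, lin_wd, if_pos hl]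
  have hPv : lin (Phi N r) v = v := by
    have : v ∈ LinearMap.ker (lin (Phi N r) - LinearMap.id) := by
      refine deg_induction ?_ hv
      intro l hl
      rw [LinearMap.mem_ker, LinearMap.sub_apply, lin_wd, Phi_short hl, LinearMap.id_apply, sub_self]
    rw [LinearMap.mem_ker, LinearMap.sub_apply, LinearMap.id_apply, sub_eq_zero] at this
    exact this
  have h1 : lin (Phi N r) (v + T m) = 0 := by
    rw [map_add, hPv, ← h]
    congr 1
    exact (LinearMap.congr_fun hT2 m).symm
  have h2 := lin_inj _ (Phi_sub hr) _ h1
  have h3 : T m = 0 := by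
    have := congrArg T h2
    rw [map_add, hTv, zero_add, map_zero] at this
    rw [← hT3]
    exact this
  refine ⟨by rw [h3, add_zero] at h2; exact h2, ?_⟩
  rw [← hT1, LinearMap.comp_apply, h3, map_zero]

end normalforms

theorem main_fp {K X B : Type*} [CommRing K] [IsNoetherianRing K] [Finite X] [NonUnitalRing B]
    [Module K B] [IsScalarTower K B B] [SMulCommClass K B B] (j : B →ₙₐ[K] UA K X)
    (hj : Function.Injective j) (hact : ∀ (b : B) (a : UA K X), ∃ b' : B, j b' = j b * a)
    (N : ℕ) (hV : ∀ a : UA K X, ∃ v ∈ deg K X (N + 1), ∃ b : B, a = v + j b) :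
    NUAlgFP K B := by
  classical
  choose φ hφ ρ hρ using hV
  choose act hact using hact
  set r : List X → UA K X := fun l => j (ρ (wd K l)) with hrdef
  have hr : ∀ l : List X, l.length = N + 1 → r l - wd K l ∈ deg K X (N + 1) := by
    intro l _
    have : r l - wd K l = - φ (wd K l) := by
      have h1 : j (ρ (wd K l)) = wd K l - φ (wd K l) := eq_sub_of_add_eq' (hρ (wd K l)).symm
      change j (ρ (wd K l)) - wd K l = _
      rw [h1]
      abel
    rw [this]
    exact neg_mem (hφ _)
  -- generators of the intersection with short words
  set P : Submodule K (UA K X) := deg K X (N + 1) ⊓ LinearMap.range (j : B →ₗ[K] UA K X) with hP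
  have hPfg : P.FG := by
    have : IsNoetherian K (deg K X (N + 1)) := isNoetherian_span_of_finite K (deg_finite _)
    exact Submodule.FG.of_le (Module.Finite.iff_fg.1 inferInstance) inf_le_left
  obtain ⟨m, p, hp⟩ := Submodule.fg_iff_exists_fin_generating_family.1 hPfg
  have hpP : ∀ i, p i ∈ P := fun i => hp ▸ Submodule.subset_span ⟨i, rfl⟩
  have hpb : ∀ i, ∃ b : B, j b = p i := fun i => (hpP i).2
  choose pb hpb using hpb
  let L := {l : List X // ¬ l.length < N + 1 ∧ l.length < 2 * (N + 1)}
  have : Finite L := ((List.finite_length_lt X (2 * (N + 1))).subset (fun l hl => hl.2) :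
    {l : List X | ¬ l.length < N + 1 ∧ l.length < 2 * (N + 1)}.Finite)
  obtain ⟨k, ⟨e⟩⟩ := Finite.exists_equiv_fin (Fin m ⊕ L)
  let f0 : Fin m ⊕ L → B := Sum.elim pb
    (fun l => act (ρ (wd K (l.1.take (N + 1)))) (wd K (l.1.drop (N + 1))))
  let f : FreeNUAlg K (Fin k) →ₙₐ[K] B :=
    MonoidAlgebra.liftMagma K (FreeSemigroup.lift (f0 ∘ e.symm))
  have hfgen : ∀ i, f (gen K i) = f0 (e.symm i) := by
    intro i
    simp [f, gen]
  let gp : Fin m → FreeNUAlg K (Fin k) := fun i => gen K (e (Sum.inl i))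
  let y : List X → FreeNUAlg K (Fin k) := fun l =>
    if h : ¬ l.length < N + 1 ∧ l.length < 2 * (N + 1) then gen K (e (Sum.inr ⟨l, h⟩)) else 0
  let g : FreeNUAlg K (Fin k) →ₙₐ[K] UA K X := j.comp f
  have hgf : ∀ x, g x = j (f x) := fun x => rfl
  have hg : ∀ l : List X, ¬ l.length < N + 1 → l.length < 2 * (N + 1) →
      g (y l) = r (l.take (N + 1)) * wd K (l.drop (N + 1)) := by
    intro l h1 h2
    have : y l = gen K (e (Sum.inr ⟨l, h1, h2⟩)) := dif_pos ⟨h1, h2⟩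
    rw [this, hgf, hfgen, Equiv.symm_apply_apply]
    exact hact _ _
  set M' : Submodule K (FreeNUAlg K (Fin k)) := LinearMap.range (lin (K := K) (Psi N y)) with hM'
  set M : Submodule K (FreeNUAlg K (Fin k)) := Submodule.span K (Set.range gp) ⊔ M' with hM
  have hfgp : ∀ i, f (gp i) = pb i := by
    intro i
    simp [gp, hfgen, f0]
  have hPsiM' : ∀ l, Psi N y l ∈ M' := fun l => ⟨wd K l, lin_wd _ _⟩
  have hygen : ∀ c : L, y c.1 = gen K (e (Sum.inr c)) := fun c => dif_pos c.2
  -- normal forms of elements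
  have hlift : ∀ b : B, ∃ x ∈ M, f x = b := by
    intro b
    obtain ⟨v, hv, a, ha⟩ := decomp hr hg (j b)
    have hvP : v ∈ P := by
      refine ⟨hv, b - f (lin (Psi N y) a), ?_⟩
      change j _ = v
      rw [map_sub, ha, hgf]
      abel
    have hvs : v ∈ (Submodule.span K (Set.range gp)).map (g : FreeNUAlg K (Fin k) →ₗ[K] UA K X) := by
      rw [← hp] at hvP
      rw [Submodule.map_span]
      convert hvP
      rw [← Set.range_comp]
      congr 1
      funext i
      change g (gp i) = p i
      rw [hgf, hfgp, hpb]
    obtain ⟨x, hx, hxv⟩ := hvs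
    refine ⟨x + lin (Psi N y) a, add_mem (Submodule.mem_sup_left hx)
      (Submodule.mem_sup_right ⟨a, rfl⟩), ?_⟩
    apply hj
    rw [← hgf, map_add, ha, ← hxv]
    rfl
  have hlift' : ∀ (c : L) (b : B), ∃ x ∈ M', f x = f (y c.1) * b := by
    intro c b
    obtain ⟨a, ha⟩ := r_mul hr hg (c.1.take (N + 1))
      (by rw [List.length_take]; have := c.2.1; omega) (wd K (c.1.drop (N + 1)) * j b)
    refine ⟨lin (Psi N y) a, ⟨a, rfl⟩, ?_⟩
    apply hj
    rw [map_mul, ← hgf, ← hgf, ← ha, hg _ c.2.1 c.2.2, mul_assoc]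
  have hrel : ∀ i i' : Fin k, ∃ x ∈ M, f x = f (gen K i) * f (gen K i') ∧
      ∀ c : L, e.symm i = Sum.inr c → x ∈ M' := by
    intro i i'
    rcases hc : e.symm i with q | c
    · obtain ⟨x, hx, hfx⟩ := hlift (f (gen K i) * f (gen K i'))
      refine ⟨x, hx, hfx, ?_⟩
      intro c hcc
      simp at hcc
    · obtain ⟨x, hx, hfx⟩ := hlift' c (f (gen K i'))
      refine ⟨x, Submodule.mem_sup_right hx, ?_, fun _ _ => hx⟩
      rw [hfx, hygen, ← hc, Equiv.apply_symm_apply]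
  choose τ hτM hτf hτM' using hrel
  -- linear relations
  let lc : (Fin m → K) →ₗ[K] FreeNUAlg K (Fin k) := Fintype.linearCombination K gp
  have hlcr : ∀ x ∈ Submodule.span K (Set.range gp), ∃ c, lc c = x := by
    intro x hx
    rw [← Fintype.range_linearCombination] at hx
    exact hx
  obtain ⟨t, ht⟩ : (LinearMap.ker ((f : FreeNUAlg K (Fin k) →ₗ[K] B) ∘ₗ lc)).FG :=
    IsNoetherian.noetherian _
  let s : Finset (FreeNUAlg K (Fin k)) := t.image lc ∪
    Finset.univ.image (fun q : Fin k × Fin k => gen K q.1 * gen K q.2 - τ q.1 q.2)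
  set I := idealSpan K (s : Set (FreeNUAlg K (Fin k))) with hI
  have hIrel : ∀ i i', gen K i * gen K i' - τ i i' ∈ I := by
    intro i i'
    apply subset_idealSpan
    rw [Finset.mem_coe]
    exact Finset.mem_union_right _ (Finset.mem_image.2 ⟨(i, i'), Finset.mem_univ _, rfl⟩)
  refine fp_criterion k f M s ?_ ?_ ?_ ?_ ?_
  · intro x hx
    rcases Finset.mem_union.1 hx with hx | hx
    · obtain ⟨c, hc, rfl⟩ := Finset.mem_image.1 hx
      have : c ∈ LinearMap.ker ((f : FreeNUAlg K (Fin k) →ₗ[K] B) ∘ₗ lc) :=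
        ht ▸ Submodule.subset_span hc
      exact this
    · obtain ⟨q, _, rfl⟩ := Finset.mem_image.1 hx
      rw [map_sub, map_mul, hτf, sub_self]
  · intro i
    rcases hc : e.symm i with q | c
    · refine Submodule.mem_sup_left (Submodule.subset_span ⟨q, ?_⟩)
      simp only [gp]
      rw [← hc, Equiv.apply_symm_apply]
    · refine Submodule.mem_sup_right ?_
      have := hPsiM' c.1
      rw [Psi_mid c.2.1 c.2.2, hygen, ← hc, Equiv.apply_symm_apply] at this
      exact this
  · intro x hx i
    have hPsi : ∀ l : List X, Psi N y l * gen K i ∈ M' ⊔ I := by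
      intro l
      induction l using list_strong with
      | _ l ih =>
      by_cases h1 : l.length < N + 1
      · rw [Psi_short h1, zero_mul]
        exact zero_mem _
      by_cases h2 : l.length < 2 * (N + 1)
      · rw [Psi_mid h1 h2]
        have h3 := hygen ⟨l, h1, h2⟩
        rw [h3]
        have h4 := hIrel (e (Sum.inr ⟨l, h1, h2⟩)) i
        have h5 := hτM' (e (Sum.inr ⟨l, h1, h2⟩)) i ⟨l, h1, h2⟩ (Equiv.symm_apply_apply _ _)
        have := add_mem (Submodule.mem_sup_left h5 : _ ∈ M' ⊔ I) (Submodule.mem_sup_right h4)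
        simpa using this
      · rw [Psi_long h2, mul_assoc]
        obtain ⟨a, ⟨a', rfl⟩, b, hb, hab⟩ := Submodule.mem_sup.1
          (ih (l.drop (N + 1)) (by rw [List.length_drop]; omega))
        rw [← hab, mul_add]
        obtain ⟨a'', ha''⟩ := y_mul_Psi (N := N) (y := y) (w := l.take (N + 1))
          (by rw [List.length_take]; omega) a'
        rw [ha'']
        exact add_mem (Submodule.mem_sup_left ⟨a'', rfl⟩)
          (Submodule.mem_sup_right (idealSpan_mul _ hb _).1)
    have hle : M ≤ (M ⊔ I).comap (LinearMap.mulRight K (gen K i)) := by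
      refine sup_le ?_ ?_
      · rw [Submodule.span_le]
        rintro _ ⟨q, rfl⟩
        change gp q * gen K i ∈ M ⊔ I
        have := add_mem (Submodule.mem_sup_left (hτM (e (Sum.inl q)) i) : _ ∈ M ⊔ I)
          (Submodule.mem_sup_right (hIrel (e (Sum.inl q)) i))
        simpa using this
      · rintro _ ⟨a, rfl⟩
        change lin (Psi N y) a * gen K i ∈ M ⊔ I
        refine (sup_le_sup_right le_sup_right I : M' ⊔ I ≤ M ⊔ I) ?_
        induction a using wd_induction with
        | h0 => rw [map_zero, zero_mul]; exact zero_mem _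
        | hadd a b ha hb => rw [map_add, add_mul]; exact add_mem ha hb
        | hsm c a ha => rw [map_smul, smul_mul_assoc]; exact Submodule.smul_mem _ _ ha
        | hw l => rw [lin_wd]; exact hPsi l
    exact hle hx
  · intro b
    obtain ⟨x, _, hx⟩ := hlift b
    exact ⟨x, hx⟩
  · intro x hx hfx
    obtain ⟨a, ha, b, ⟨b', rfl⟩, rfl⟩ := Submodule.mem_sup.1 hx
    obtain ⟨c, rfl⟩ := hlcr a ha
    have hgx : g (lc c) + g (lin (Psi N y) b') = 0 := by
      rw [← map_add, hgf, hfx, map_zero]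
    have hdeg : g (lc c) ∈ deg K X (N + 1) := by
      have : Submodule.span K (Set.range gp) ≤
          (deg K X (N + 1)).comap (g : FreeNUAlg K (Fin k) →ₗ[K] UA K X) := by
        rw [Submodule.span_le]
        rintro _ ⟨q, rfl⟩
        change g (gp q) ∈ deg K X (N + 1)
        rw [hgf, hfgp, hpb]
        exact (hpP q).1
      exact this ha
    obtain ⟨h1, h2⟩ := normal_inj hr hg _ hdeg b' hgx
    rw [h2, add_zero]
    have hc : c ∈ LinearMap.ker ((f : FreeNUAlg K (Fin k) →ₗ[K] B) ∘ₗ lc) := by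
      change f (lc c) = 0
      apply hj
      rw [← hgf, h1, map_zero]
    have hle : LinearMap.ker ((f : FreeNUAlg K (Fin k) →ₗ[K] B) ∘ₗ lc) ≤ I.comap lc := by
      rw [← ht, Submodule.span_le]
      intro c hc
      change lc c ∈ I
      apply subset_idealSpan
      rw [Finset.mem_coe]
      exact Finset.mem_union_left _ (Finset.mem_image_of_mem _ hc)
    exact hle hc

lemma exists_mem_deg {K X : Type*} [CommRing K] (a : UA K X) : ∃ n, a ∈ deg K X n :=
  ⟨a.coeff.support.sup FreeMonoid.length + 1,
    mem_deg_of_coeff fun _ hl => Nat.lt_succ_of_le (Finset.le_sup (f := FreeMonoid.length) hl)⟩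

end RightIdealFP

/-- Let `K` be a commutative Noetherian ring with identity, `K⟨X⟩` the
free `K`-algebra on a finite set `X`, and `R` a right ideal of `K⟨X⟩` (a `K`-submodule
closed under right multiplication by arbitrary elements, here packaged as a
`K`-subalgebra with the right ideal property) such that `K⟨X⟩/R` is a finitely generated
`K`-module. Then `R` is finitely presented as a `K`-algebra. -/
theorem right_ideal_finite_corank_fp
    (K X : Type*) [CommRing K] [IsNoetherianRing K] [Finite X]
    (R : NonUnitalSubalgebra K (FreeNUAlg K X))
    (hright : ∀ r ∈ R, ∀ a : FreeNUAlg K X, r * a ∈ R)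
    (hcorank : Module.Finite K (FreeNUAlg K X ⧸ R.toSubmodule)) :
    NUAlgFP K R := by
  open RightIdealFP in
  classical
  let ι : FreeNUAlg K X →ₙₐ[K] UA K X :=
    MonoidAlgebra.mapDomainNonUnitalAlgHom K K (FreeSemigroup.toFreeMonoid (α := X))
  have hι : Function.Injective ι :=
    MonoidAlgebra.mapDomain_injective FreeSemigroup.toFreeMonoid_injective
  have hιs : ∀ w, ι (MonoidAlgebra.single w 1)
      = MonoidAlgebra.single (FreeSemigroup.toFreeMonoid w) 1 :=
    fun w => MonoidAlgebra.mapDomain_single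
  let j : R →ₙₐ[K] UA K X := ι.comp (NonUnitalSubalgebraClass.subtype R)
  have hjι : ∀ b : R, j b = ι (b : FreeNUAlg K X) := fun b => rfl
  -- bounded degree
  obtain ⟨q, u, hu⟩ := Module.Finite.exists_fin (R := K) (M := FreeNUAlg K X ⧸ R.toSubmodule)
  choose u' hu' using fun i => Submodule.mkQ_surjective R.toSubmodule (u i)
  choose d hd using fun i => exists_mem_deg (ι (u' i))
  have hspan : R.toSubmodule ⊔ Submodule.span K (Set.range u') = ⊤ := by
    rw [← Submodule.map_mkQ_eq_top, Submodule.map_span, ← Set.range_comp, ← hu]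
    congr 2
    funext i
    exact hu' i
  refine main_fp j (hι.comp Subtype.val_injective) ?_ (Finset.univ.sup d) ?_
  · intro b a
    induction a using wd_induction with
    | h0 => exact ⟨0, by rw [map_zero, mul_zero]⟩
    | hadd a a' ha ha' =>
      obtain ⟨c, hc⟩ := ha
      obtain ⟨c', hc'⟩ := ha'
      exact ⟨c + c', by rw [map_add, hc, hc', mul_add]⟩
    | hsm k a ha =>
      obtain ⟨c, hc⟩ := ha
      exact ⟨k • c, by rw [map_smul, hc, mul_smul_comm]⟩
    | hw l =>
      rcases FreeSemigroup.eq_one_or_toFreeMonoid (FreeMonoid.ofList l) with h | ⟨w, hw⟩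
      · refine ⟨b, ?_⟩
        rw [wd, h, ← MonoidAlgebra.one_def, mul_one]
      · refine ⟨⟨(b : FreeNUAlg K X) * MonoidAlgebra.single w 1, hright _ b.2 _⟩, ?_⟩
        rw [hjι, hjι, map_mul, hιs, hw, wd]
  · set N := Finset.univ.sup d with hN
    have hle : (⊤ : Submodule K (FreeNUAlg K X)) ≤ (deg K X (N + 1) ⊔
        LinearMap.range (j : R →ₗ[K] UA K X)).comap (ι : FreeNUAlg K X →ₗ[K] UA K X) := by
      rw [← hspan]
      refine sup_le ?_ ?_
      · intro b hb
        exact Submodule.mem_sup_right ⟨⟨b, hb⟩, rfl⟩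
      · rw [Submodule.span_le]
        rintro _ ⟨i, rfl⟩
        refine Submodule.mem_sup_left (deg_mono ?_ (hd i))
        exact (Finset.le_sup (f := d) (Finset.mem_univ i)).trans (Nat.le_succ _)
    intro a
    have ha : a ∈ deg K X (N + 1) ⊔ LinearMap.range (j : R →ₗ[K] UA K X) := by
      induction a using wd_induction with
      | h0 => exact zero_mem _
      | hadd a b ha hb => exact add_mem ha hb
      | hsm c a ha => exact Submodule.smul_mem _ _ ha
      | hw l =>
        rcases FreeSemigroup.eq_one_or_toFreeMonoid (FreeMonoid.ofList l) with h | ⟨w, hw⟩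
        · have : l = [] := h
          subst this
          exact Submodule.mem_sup_left (wd_mem_deg (Nat.succ_pos _))
        · have := hle (Submodule.mem_top (x := MonoidAlgebra.single w (1 : K)))
          have h2 : ι (MonoidAlgebra.single w 1) ∈ deg K X (N + 1) ⊔
            LinearMap.range (j : R →ₗ[K] UA K X) := this
          rwa [hιs, hw] at h2
    obtain ⟨v, hv, _, ⟨b, rfl⟩, rfl⟩ := Submodule.mem_sup.1 ha
    exact ⟨v, hv, b, rfl⟩
end

section
/- Let K be a Noetherian integral domain and let K⟨X⟩ be a free K-algebra on a nonempty set X. Then no proper K-subalgebra S of K⟨X⟩ with finitely generated quotient K-module K⟨X⟩/S is free as a K-algebra, i.e. no such S is isomorphic as a K-algebra to a free K-algebra K⟨Y⟩ on any set Y. -/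
section Core
open Polynomial

/-- The unital free algebra. -/
abbrev UFA (K Y : Type*) [CommRing K] : Type _ := MonoidAlgebra K (FreeMonoid Y)

variable {K Y : Type*} [CommRing K]

/-- The grading map `w ↦ w T^{|w|}`. -/
noncomputable def gr (K Y : Type*) [CommRing K] : UFA K Y →ₐ[K] (UFA K Y)[X] :=
  MonoidAlgebra.lift K (UFA K Y)[X] (FreeMonoid Y)
    (FreeMonoid.lift fun y => Polynomial.monomial 1 (MonoidAlgebra.of K _ (FreeMonoid.of y)))

lemma gr_single (w : FreeMonoid Y) (c : K) :
    gr K Y (MonoidAlgebra.single w c) =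
      Polynomial.monomial w.length (MonoidAlgebra.single w c) := by
  have h : ∀ w : FreeMonoid Y, (FreeMonoid.lift fun y =>
      Polynomial.monomial 1 (MonoidAlgebra.of K _ (FreeMonoid.of y))) w =
      Polynomial.monomial w.length (MonoidAlgebra.single w (1:K)) := by
    intro w
    induction w using FreeMonoid.inductionOn' with
    | one => simp [← MonoidAlgebra.one_def]
    | of_mul x xs ih =>
      rw [map_mul, ih, FreeMonoid.lift_eval_of, Polynomial.monomial_mul_monomial]
      simp [MonoidAlgebra.single_mul_single, FreeMonoid.length_mul]
  rw [gr, MonoidAlgebra.lift_single, h, Polynomial.smul_monomial]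
  simp

lemma gr_coeff (f : UFA K Y) (n : ℕ) (w : FreeMonoid Y) :
    ((gr K Y f).coeff n).coeff w = if w.length = n then f.coeff w else 0 := by
  induction f using MonoidAlgebra.induction_linear with
  | zero => simp
  | add f g hf hg =>
    rw [map_add, Polynomial.coeff_add, MonoidAlgebra.coeff_add, MonoidAlgebra.coeff_add,
      Finsupp.add_apply, Finsupp.add_apply, hf, hg]
    split_ifs <;> simp
  | single z c =>
    classical
    rw [gr_single, Polynomial.coeff_monomial]
    by_cases hz : z = w
    · subst hz; split_ifs <;> simp
    · split_ifs <;> simp [MonoidAlgebra.coeff_single, hz]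

lemma gr_inj : Function.Injective (gr K Y) := by
  intro f g h
  ext w
  have := congrArg (fun p => (p.coeff w.length).coeff w) h
  simpa [gr_coeff] using this

/-- the degree -/
noncomputable def dg (f : UFA K Y) : ℕ := (gr K Y f).natDegree
/-- the leading homogeneous part -/
noncomputable def lead (f : UFA K Y) : UFA K Y := (gr K Y f).leadingCoeff

lemma lead_coeff (f : UFA K Y) (w : FreeMonoid Y) :
    (lead f).coeff w = if w.length = dg f then f.coeff w else 0 := gr_coeff _ _ _

lemma dg_mul [IsDomain K] {f g : UFA K Y} (hf : f ≠ 0) (hg : g ≠ 0) : dg (f * g) = dg f + dg g := by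
  unfold dg
  rw [map_mul, Polynomial.natDegree_mul] <;> rwa [Ne, map_eq_zero_iff _ gr_inj]

lemma lead_mul [IsDomain K] (f g : UFA K Y) : lead (f * g) = lead f * lead g := by
  unfold lead
  rw [map_mul, Polynomial.leadingCoeff_mul]

lemma lead_ne_zero {f : UFA K Y} (hf : f ≠ 0) : lead f ≠ 0 := by
  unfold lead
  rwa [Ne, Polynomial.leadingCoeff_eq_zero, map_eq_zero_iff _ gr_inj]

lemma dg_le_iff (f : UFA K Y) (n : ℕ) :
    dg f ≤ n ↔ ∀ w, n < w.length → f.coeff w = 0 := by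
  unfold dg
  rw [Polynomial.natDegree_le_iff_coeff_eq_zero]
  constructor
  · intro h w hw
    have := congrArg (fun p => p.coeff w) (h _ hw)
    simpa [gr_coeff] using this
  · intro h N hN
    ext w
    rw [gr_coeff]
    split_ifs with h'
    · simpa using h w (h' ▸ hN)
    · simp

lemma eq_scalar_of_dg {f : UFA K Y} (h : dg f ≤ 0) : f = algebraMap K _ (f.coeff 1) := by
  classical
  rw [dg_le_iff] at h
  ext w
  rw [MonoidAlgebra.coe_algebraMap]
  by_cases hw : w = 1
  · subst hw; simp
  · rw [h w]
    · simp [MonoidAlgebra.coeff_single, Ne.symm hw]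
    · rw [Nat.pos_iff_ne_zero, Ne, FreeMonoid.length_eq_zero]; exact hw

/-- left division by a word -/
noncomputable def ldiv (w : FreeMonoid Y) (f : UFA K Y) : UFA K Y :=
  MonoidAlgebra.comapDomain (w * ·) (mul_right_injective w) f

lemma ldiv_coeff (w x : FreeMonoid Y) (f : UFA K Y) : (ldiv w f).coeff x = f.coeff (w * x) := by
  simp [ldiv]

lemma ldiv_add (w : FreeMonoid Y) (f g : UFA K Y) : ldiv w (f + g) = ldiv w f + ldiv w g := by
  ext x; simp [ldiv_coeff]

lemma ldiv_zero (w : FreeMonoid Y) : ldiv w (0 : UFA K Y) = 0 := by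
  ext x; simp [ldiv_coeff]

lemma ldiv_single_mul (w : FreeMonoid Y) (f : UFA K Y) :
    ldiv w (MonoidAlgebra.single w 1 * f) = f := by
  ext x
  rw [ldiv_coeff, MonoidAlgebra.coeff_single_mul_eq_mul_coeff (m₂ := x), one_mul]
  intro z _
  exact mul_right_inj w

lemma prefix_aux {w z d x : FreeMonoid Y} (hl : w.length ≤ z.length) (h : z * d = w * x) :
    ∃ z', z = w * z' := by
  have h' : z.toList ++ d.toList = w.toList ++ x.toList := by
    have := congrArg FreeMonoid.toList h
    simpa using this
  have : w.toList <+: z.toList := List.prefix_of_prefix_length_le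
    (l₃ := z.toList ++ d.toList) (by rw [h']; exact List.prefix_append _ _)
    (List.prefix_append _ _) hl
  obtain ⟨t, ht⟩ := this
  refine ⟨FreeMonoid.ofList t, ?_⟩
  apply FreeMonoid.toList.injective
  simp [ht]

lemma ldiv_mul_single (w z : FreeMonoid Y) (c : K) (hl : w.length ≤ z.length) (g : UFA K Y) :
    ldiv w (MonoidAlgebra.single z c * g) = ldiv w (MonoidAlgebra.single z c) * g := by
  classical
  by_cases h : ∃ z', z = w * z'
  · obtain ⟨z', rfl⟩ := h
    have : (MonoidAlgebra.single (w * z') c : UFA K Y) =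
      MonoidAlgebra.single w 1 * MonoidAlgebra.single z' c := by
      rw [MonoidAlgebra.single_mul_single, one_mul]
    rw [this, mul_assoc, ldiv_single_mul, ldiv_single_mul]
  · have h0 : ldiv w (MonoidAlgebra.single z c) = 0 := by
      ext x
      rw [ldiv_coeff, MonoidAlgebra.coeff_single, Finsupp.single_apply, if_neg]
      · simp
      · intro e; exact h ⟨x, e⟩
    rw [h0, zero_mul]
    ext x
    rw [ldiv_coeff, MonoidAlgebra.coeff_single_mul_of_forall_mul_ne]
    · simp
    · intro d e; exact h (prefix_aux hl e)

lemma ldiv_mul (w : FreeMonoid Y) (f g : UFA K Y)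
    (hf : ∀ z, f.coeff z ≠ 0 → w.length ≤ z.length) : ldiv w (f * g) = ldiv w f * g := by
  have key : ∀ s : Finset (FreeMonoid Y), (∀ z ∈ s, w.length ≤ z.length) →
      ldiv w ((∑ z ∈ s, MonoidAlgebra.single z (f.coeff z)) * g) =
      ldiv w (∑ z ∈ s, MonoidAlgebra.single z (f.coeff z)) * g := by
    classical
    intro s
    induction s using Finset.induction_on with
    | empty => intro _; simp [ldiv_zero]
    | insert a s ha ih =>
      intro h
      rw [Finset.sum_insert ha, add_mul, ldiv_add, ldiv_add, add_mul,
        ih (fun z hz => h z (Finset.mem_insert_of_mem hz)),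
        ldiv_mul_single _ _ _ (h a (Finset.mem_insert_self _ _))]
  have h2 := key f.coeff.support (fun z hz => hf z (Finsupp.mem_support_iff.1 hz))
  have h3 : ∑ z ∈ f.coeff.support, MonoidAlgebra.single z (f.coeff z) = f :=
    MonoidAlgebra.sum_coeff_single f
  rwa [h3] at h2

/-- key division step -/
lemma key_step [IsDomain K] {u1 v v' u0 : UFA K Y} (hu1 : u1 ≠ 0) (hv : v ≠ 0) (hv' : v' ≠ 0)
    (hu0 : u0 ≠ 0) (h : u1 * v = v' * u0) (n : ℕ) (hn : dg v = dg u0 + (n + 1)) :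
    ∃ (r : K) (c : UFA K Y), r ≠ 0 ∧ dg (r • v - c * u0) ≤ dg u0 + n := by
  have hd : dg v' = dg u1 + (n + 1) := by
    have := congrArg dg h
    rw [dg_mul hu1 hv, dg_mul hv' hu0] at this
    omega
  have hl : lead u1 * lead v = lead v' * lead u0 := by
    rw [← lead_mul, ← lead_mul, h]
  obtain ⟨w, hw⟩ : ∃ w, (lead u1).coeff w ≠ 0 := by
    by_contra! hc
    exact lead_ne_zero hu1 (by ext w; simpa using hc w)
  have hwl : w.length = dg u1 := by
    by_contra hc
    rw [lead_coeff, if_neg hc] at hw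
    exact hw rfl
  set r := (lead u1).coeff w
  set c := ldiv w (lead v')
  have e1 : ldiv w (lead u1) = algebraMap K _ r := by
    classical
    ext x
    rw [ldiv_coeff, MonoidAlgebra.coe_algebraMap]
    by_cases hx : x = 1
    · subst hx; simp [r]
    · have : x.length ≠ 0 := by rw [Ne, FreeMonoid.length_eq_zero]; exact hx
      rw [lead_coeff, if_neg (by rw [FreeMonoid.length_mul]; omega)]
      simp [MonoidAlgebra.coeff_single, Ne.symm hx]
  have e2 : r • lead v = c * lead u0 := by
    have := congrArg (ldiv w) hl
    rw [ldiv_mul, ldiv_mul, e1, ← Algebra.smul_def] at this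
    · exact this
    · intro z hz
      by_contra hc
      rw [lead_coeff, if_neg (by omega)] at hz
      exact hz rfl
    · intro z hz
      by_contra hc
      rw [lead_coeff, if_neg (by omega)] at hz
      exact hz rfl
  have hc : gr K Y c = Polynomial.monomial (n+1) c := by
    ext N x
    rw [gr_coeff, Polynomial.coeff_monomial]
    have hx : c.coeff x = if x.length = n + 1 then v'.coeff (w * x) else 0 := by
      rw [ldiv_coeff, lead_coeff, FreeMonoid.length_mul, hd, hwl]
      simp
    by_cases h1 : n + 1 = N
    · subst h1
      rw [if_pos rfl, hx]; split_ifs <;> rfl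
    · rw [if_neg h1, hx]
      split_ifs
      · omega
      · simp
      · simp
  refine ⟨r, c, hw, ?_⟩
  unfold dg
  rw [Polynomial.natDegree_le_iff_coeff_eq_zero]
  intro N hN
  change dg u0 + n < N at hN
  rw [map_sub, map_smul, map_mul, hc, Polynomial.coeff_sub, Polynomial.coeff_smul]
  obtain ⟨k, rfl⟩ : ∃ k, N = k + (n + 1) := ⟨N - (n+1), by omega⟩
  rw [Polynomial.coeff_monomial_mul]
  by_cases hk : k = dg u0
  · subst hk
    rw [← hn]
    exact sub_eq_zero.2 e2
  · rw [Polynomial.coeff_eq_zero_of_natDegree_lt (p := gr K Y v) (by change dg v < _; omega),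
      Polynomial.coeff_eq_zero_of_natDegree_lt (p := gr K Y u0) (by change dg u0 < _; omega)]
    simp

end Core

section Core2
open Polynomial

variable {K Y : Type*} [CommRing K]

lemma exists_ker {K M N : Type*} [CommRing K] [AddCommGroup M] [AddCommGroup N] [Module K M]
    [Module K N] [IsNoetherian K N] (hM : ¬ Module.Finite K M) (φ : M →ₗ[K] N) :
    ∃ x, x ≠ 0 ∧ φ x = 0 := by
  by_contra! h
  apply hM
  have hinj : Function.Injective φ := by
    rw [injective_iff_map_eq_zero]
    intro x hx
    by_contra hc
    exact h x hc hx
  have := isNoetherian_of_injective φ hinj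
  infer_instance

lemma poly_not_finite [Nontrivial K] : ¬ Module.Finite K K[X] :=
  Polynomial.not_finite

theorem core [IsDomain K] [IsNoetherianRing K] {A : Type*} [Ring A] [Algebra K A] [IsDomain A]
    [IsDomain (UFA K Y)] [Module.IsTorsionFree K A]
    (j : UFA K Y →ₐ[K] A) (hj : Function.Injective j)
    (hcor : Module.Finite K (A ⧸ LinearMap.range j.toLinearMap))
    (hinf : ¬ Module.Finite K A)
    (halg : ∀ a : A, ∀ p : K[X], p ≠ 0 → aeval a p = 0 → ∃ k, a = algebraMap K A k) :
    Function.Surjective j := by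
  set T := LinearMap.range j.toLinearMap with hT
  have memT : ∀ a, a ∈ T ↔ ∃ b, j b = a := fun a => Iff.rfl
  have hBinf : ¬ Module.Finite K (UFA K Y) := by
    intro h
    apply hinf
    have : Module.Finite K T := inferInstance
    exact Module.Finite.of_submodule_quotient T
  -- generators
  obtain ⟨s, hs⟩ : ∃ s : Finset A, T ⊔ Submodule.span K (s : Set A) = ⊤ := by
    obtain ⟨s, hs⟩ := hcor.fg_top
    classical
    refine ⟨s.image (Function.surjInv T.mkQ_surjective), ?_⟩
    have hmap : Submodule.map T.mkQ (Submodule.span K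
        ((s.image (Function.surjInv T.mkQ_surjective) : Finset A) : Set A)) = ⊤ := by
      rw [Submodule.map_span, Finset.coe_image, Set.image_image]
      simp only [Function.surjInv_eq]
      simpa using hs
    have := congrArg (Submodule.comap T.mkQ) hmap
    rwa [Submodule.comap_map_mkQ, Submodule.comap_top] at this
  have gen : ∀ P : Submodule K A, T ≤ P → (∀ v ∈ s, v ∈ P) → ∀ a, a ∈ P := by
    intro P h1 h2 a
    have : T ⊔ Submodule.span K (s : Set A) ≤ P := sup_le h1 (Submodule.span_le.2 h2)
    rw [hs] at this
    exact this trivial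
  -- u0, u1
  obtain ⟨u0, hu0, hL⟩ : ∃ u0 : UFA K Y, u0 ≠ 0 ∧ ∀ a, a * j u0 ∈ T := by
    obtain ⟨u, hu, hu'⟩ := exists_ker hBinf (LinearMap.pi (fun v : s =>
      T.mkQ ∘ₗ (LinearMap.mulLeft K (v : A)) ∘ₗ j.toLinearMap))
    refine ⟨u, hu, gen (T.comap (LinearMap.mulRight K (j u))) ?_ ?_⟩
    · rintro _ ⟨b, rfl⟩
      exact ⟨b * u, by simp⟩
    · intro v hv
      have := congrFun hu' ⟨v, hv⟩
      simpa using this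
  obtain ⟨u1, hu1, hR⟩ : ∃ u1 : UFA K Y, u1 ≠ 0 ∧ ∀ a, j u1 * a ∈ T := by
    obtain ⟨u, hu, hu'⟩ := exists_ker hBinf (LinearMap.pi (fun v : s =>
      T.mkQ ∘ₗ (LinearMap.mulRight K (v : A)) ∘ₗ j.toLinearMap))
    refine ⟨u, hu, gen (T.comap (LinearMap.mulLeft K (j u))) ?_ ?_⟩
    · rintro _ ⟨b, rfl⟩
      exact ⟨u * b, by simp⟩
    · intro v hv
      have := congrFun hu' ⟨v, hv⟩
      simpa using this
  choose L hL using hL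
  choose R hR using hR
  simp only [AlgHom.toLinearMap_apply] at hL hR
  have r1 : ∀ a, u1 * L a = R a * u0 := fun a => hj (by simp [hL, hR, mul_assoc])
  have r2 : ∀ a b, R a * L b = u1 * L (a * b) := fun a b => hj (by simp [hL, hR, mul_assoc])
  have r3 : ∀ b, L (j b) = b * u0 := fun b => hj (by simp [hL])
  have Ladd : ∀ a b, L (a + b) = L a + L b := fun a b => hj (by simp [hL, add_mul])
  have Lsub : ∀ a b, L (a - b) = L a - L b := fun a b => hj (by simp [hL, sub_mul])
  have Lsmul : ∀ (r : K) a, L (r • a) = r • L a := fun a b => hj (by simp [hL])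
  have ju0 : j u0 ≠ 0 := by rwa [Ne, map_eq_zero_iff _ hj]
  have ju1 : j u1 ≠ 0 := by rwa [Ne, map_eq_zero_iff _ hj]
  have L0 : ∀ a, a ≠ 0 → L a ≠ 0 := by
    intro a ha h
    have := hL a
    rw [h, map_zero] at this
    exact mul_ne_zero ha ju0 this.symm
  have R0 : ∀ a, a ≠ 0 → R a ≠ 0 := by
    intro a ha h
    have := hR a
    rw [h, map_zero] at this
    exact mul_ne_zero ju1 ha this.symm
  have dgadd : ∀ (f g : UFA K Y) n, dg f ≤ n → dg g ≤ n → dg (f + g) ≤ n := by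
    intro f g n hf hg
    rw [dg_le_iff] at *
    intro w hw
    simp [hf w hw, hg w hw]
  have dgsmul : ∀ (r : K) (f : UFA K Y) n, dg f ≤ n → dg (r • f) ≤ n := by
    intro r f n hf
    rw [dg_le_iff] at *
    intro w hw
    simp [hf w hw]
  -- Step A
  have stepA : ∀ a, dg (L a) ≤ dg u0 → ∃ k, a = algebraMap K A k := by
    intro a ha
    by_cases ha0 : a = 0
    · exact ⟨0, by simp [ha0]⟩
    have hRa : dg (R a) ≤ dg u1 := by
      have := congrArg dg (r1 a)
      rw [dg_mul hu1 (L0 a ha0), dg_mul (R0 a ha0) hu0] at this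
      omega
    have hpow : ∀ n, dg (L (a ^ n)) ≤ dg u0 := by
      intro n
      induction n with
      | zero =>
        have := r3 1
        rw [map_one, one_mul] at this
        rw [pow_zero, this]
      | succ n ih =>
        have := congrArg dg (r2 a (a ^ n))
        rw [dg_mul (R0 a ha0) (L0 _ (pow_ne_zero _ ha0)), ← pow_succ',
          dg_mul hu1 (L0 _ (pow_ne_zero _ ha0))] at this
        omega
    have hp : ∀ p : K[X], dg (L (aeval a p)) ≤ dg u0 := by
      intro p
      induction p using Polynomial.induction_on' with
      | add p q hp hq => rw [map_add, Ladd]; exact dgadd _ _ _ hp hq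
      | monomial n c =>
        rw [aeval_monomial, ← Algebra.smul_def, Lsmul]
        exact dgsmul _ _ _ (hpow n)
    obtain ⟨p, hp0, hpT⟩ := exists_ker (poly_not_finite (K := K))
      (T.mkQ ∘ₗ (aeval a).toLinearMap ∘ₗ LinearMap.mulLeft K (X : K[X]))
    have hmem : aeval a (X * p) ∈ T := by simpa using hpT
    obtain ⟨b, hb⟩ := hmem
    simp only [AlgHom.toLinearMap_apply] at hb
    have hbd : dg b ≤ 0 := by
      by_cases hb0 : b = 0
      · subst hb0; rw [dg_le_iff]; simp
      have := hp (X * p)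
      rw [← hb, r3, dg_mul hb0 hu0] at this
      omega
    rw [eq_scalar_of_dg hbd, AlgHom.commutes] at hb
    refine halg a (X * p - C (b.coeff 1)) ?_ ?_
    · intro h
      rw [sub_eq_zero] at h
      have hd := congrArg natDegree h
      rw [natDegree_X_mul hp0, natDegree_C] at hd
      omega
    · rw [map_sub, aeval_C, hb, sub_self]
  -- Step B
  have stepB : ∀ n a, dg (L a) ≤ dg u0 + n → ∃ r : K, r ≠ 0 ∧ r • a ∈ T := by
    intro n
    induction n with
    | zero =>
      intro a ha
      obtain ⟨k, rfl⟩ := stepA a ha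
      exact ⟨1, one_ne_zero, algebraMap K _ k, by
        rw [one_smul]; exact j.commutes k⟩
    | succ n ih =>
      intro a ha
      by_cases h' : dg (L a) ≤ dg u0 + n
      · exact ih a h'
      have ha0 : a ≠ 0 := by
        rintro rfl
        apply h'
        have : L 0 = 0 := hj (by simp [hL])
        rw [this, dg_le_iff]; simp
      obtain ⟨r, c, hr, hrc⟩ := key_step hu1 (L0 a ha0) (R0 a ha0) hu0 (r1 a) n (by omega)
      rw [← r3, ← Lsmul, ← Lsub] at hrc
      obtain ⟨r', hr', hm⟩ := ih _ hrc
      refine ⟨r' * r, mul_ne_zero hr' hr, ?_⟩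
      rw [smul_sub, smul_smul] at hm
      have h2 : r' • j c ∈ T := ⟨r' • c, by simp⟩
      simpa using T.add_mem hm h2
  have tors : ∀ a, ∃ r : K, r ≠ 0 ∧ r • a ∈ T := fun a => stepB (dg (L a)) a (by omega)
  -- Step C
  choose ρ hρ0 hρ using tors
  obtain ⟨r, hr0, hr⟩ : ∃ r : K, r ≠ 0 ∧ ∀ a, r • a ∈ T := by
    refine ⟨∏ v ∈ s, ρ v, Finset.prod_ne_zero_iff.2 fun v _ => hρ0 v, ?_⟩
    refine gen (T.comap (LinearMap.lsmul K A (∏ v ∈ s, ρ v))) ?_ ?_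
    · intro a ha
      exact T.smul_mem _ ha
    · intro v hv
      classical
      rw [Submodule.mem_comap, LinearMap.lsmul_apply, ← Finset.prod_erase_mul _ _ hv, mul_smul]
      exact T.smul_mem _ (hρ v)
  choose β hβ using hr
  simp only [AlgHom.toLinearMap_apply] at hβ
  have bj : ∀ b, β (j b) = r • b := fun b => hj (by simp [hβ])
  have badd : ∀ a b, β (a + b) = β a + β b := fun a b => hj (by simp [hβ])
  have bsmul : ∀ (k : K) a, β (k • a) = k • β a := fun k a => hj (by
    rw [hβ, map_smul, hβ, smul_comm])
  have bmul : ∀ b a, β (j b * a) = b * β a := fun k a => hj (by simp [hβ])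
  have high : ∀ a w, s.sup (fun v => dg (β v)) < w.length → r ∣ (β a).coeff w := by
    intro a w hw
    let P : Submodule K A :=
      { carrier := {a | r ∣ (β a).coeff w}
        add_mem' := by
          intro a b ha hb
          simp only [Set.mem_ofPred_eq] at *
          rw [badd]
          simpa using dvd_add ha hb
        zero_mem' := by
          have : β 0 = 0 := hj (by simp [hβ])
          simp [this]
        smul_mem' := by
          intro k a ha
          simp only [Set.mem_ofPred_eq] at *
          rw [bsmul]
          simpa using Dvd.dvd.mul_left ha k }
    refine gen P ?_ ?_ a
    · rintro _ ⟨b, rfl⟩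
      change r ∣ (β (j b)).coeff w
      rw [bj]
      simp
    · intro v hv
      change r ∣ (β v).coeff w
      rw [(dg_le_iff (β v) (dg (β v))).1 le_rfl w]
      · exact dvd_zero _
      · exact lt_of_le_of_lt (Finset.le_sup (f := fun v => dg (β v)) hv) hw
  obtain ⟨y⟩ : Nonempty Y := by
    by_contra hY
    rw [not_nonempty_iff] at hY
    apply hBinf
    have hsurj : Function.Surjective (Algebra.linearMap K (UFA K Y)) := by
      intro f
      refine ⟨f.coeff 1, ?_⟩
      refine (eq_scalar_of_dg ?_).symm
      rw [dg_le_iff]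
      intro w hw
      have : w = 1 := Subsingleton.elim _ _
      subst this
      simp at hw
    exact Module.Finite.of_surjective _ hsurj
  have all : ∀ a w, r ∣ (β a).coeff w := by
    intro a w
    set N := s.sup (fun v => dg (β v))
    let z : FreeMonoid Y := FreeMonoid.of y ^ (N + 1)
    have hz : z.length = N + 1 := by
      have : ∀ n, (FreeMonoid.of y ^ n).length = n := by
        intro n
        induction n with
        | zero => simp
        | succ n ih => rw [pow_succ, FreeMonoid.length_mul, ih]; simp
      exact this _
    have := high (j (MonoidAlgebra.single z 1) * a) (z * w) (by
      rw [FreeMonoid.length_mul, hz]; omega)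
    rw [bmul] at this
    have h2 := ldiv_coeff z w (MonoidAlgebra.single z 1 * β a)
    rw [ldiv_single_mul] at h2
    rwa [h2]
  intro a
  choose q hq using all a
  have hfin : (Function.support q).Finite := by
    apply (β a).coeff.support.finite_toSet.subset
    intro w hw
    simp only [Finset.mem_coe, Finsupp.mem_support_iff]
    rw [hq]
    exact mul_ne_zero hr0 hw
  refine ⟨.ofCoeff (Finsupp.ofSupportFinite q hfin), ?_⟩
  have e : β a = r • (.ofCoeff (Finsupp.ofSupportFinite q hfin)) := by
    ext w
    rw [hq]
    simp [Finsupp.ofSupportFinite_coe]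
  have e2 := congrArg j e
  rw [hβ, map_smul] at e2
  exact (smul_right_injective A hr0 e2).symm

end Core2

section Glue
open Polynomial
variable {K X : Type*} [CommRing K]

lemma ufa_alg [IsDomain K] [IsDomain (UFA K X)] (a : UFA K X) (p : K[X]) (hp : p ≠ 0) (h : aeval a p = 0) :
    ∃ k, a = algebraMap K (UFA K X) k := by
  let ε : UFA K X →ₐ[K] K := MonoidAlgebra.lift K K (FreeMonoid X) (FreeMonoid.lift fun _ => 0)
  refine ⟨ε a, ?_⟩
  by_contra hne
  set b := a - algebraMap K (UFA K X) (ε a) with hb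
  have hb0 : b ≠ 0 := sub_ne_zero.2 hne
  have hεb : ε b = 0 := by
    rw [hb, map_sub, AlgHom.commutes]; simp
  set q := p.comp (Polynomial.X + C (ε a)) with hq
  have hq0 : q ≠ 0 := by
    rw [hq, Ne, comp_X_add_C_eq_zero_iff]; exact hp
  have hqb : aeval b q = 0 := by
    rw [hq, aeval_comp]; simp [hb, h]
  obtain ⟨n, t, ht, hqt⟩ : ∃ n t, ¬ (Polynomial.X : K[X]) ∣ t ∧ q = Polynomial.X ^ n * t := by
    obtain ⟨n, t, h1, h2⟩ := (Polynomial.finiteMultiplicity_X_sub_C (0:K) hq0).exists_eq_pow_mul_and_not_dvd |>.imp (fun _ h => h) |> fun h => (⟨_, h.choose, h.choose_spec.2, h.choose_spec.1⟩ : ∃ n t, ¬ (Polynomial.X - C (0:K)) ∣ t ∧ q = (Polynomial.X - C (0:K))^n * t)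
    exact ⟨n, t, by simpa using h1, by simpa using h2⟩
  rw [hqt, map_mul, map_pow, aeval_X] at hqb
  have htb : aeval b t = 0 := (mul_eq_zero.1 hqb).resolve_left (pow_ne_zero _ hb0)
  have := congrArg ε htb
  rw [← Polynomial.aeval_algHom_apply, hεb, map_zero] at this
  apply ht
  rw [X_dvd_iff, coeff_zero_eq_eval_zero]
  simpa using this

lemma ufa_not_finite [Nontrivial K] [Nonempty X] : ¬ Module.Finite K (UFA K X) := by
  intro h
  have : Module.Finite K (FreeMonoid X →₀ K) :=
    Module.Finite.equiv (MonoidAlgebra.coeffLinearEquiv K)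
  have hf : Finite (FreeMonoid X) :=
    Module.Finite.finite_basis (Finsupp.basisSingleOne (R := K) (ι := FreeMonoid X))
  have hi : Infinite (List X) := inferInstance
  exact hi.not_finite hf

/-- embedding of free semigroup in free monoid -/
def sgm (X : Type*) : FreeSemigroup X →ₙ* FreeMonoid X := FreeSemigroup.lift FreeMonoid.of

lemma sgm_eq (w : FreeSemigroup X) : sgm X w = FreeMonoid.ofList (w.head :: w.tail) := by
  induction w using FreeSemigroup.recOnMul with
  | ih1 x => rfl
  | ih2 x y h1 h2 => rw [map_mul, h1, h2]; rfl

lemma sgm_inj : Function.Injective (sgm X) := by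
  intro a b h
  rw [sgm_eq, sgm_eq] at h
  have := FreeMonoid.ofList.injective h
  ext1
  · exact (List.cons.inj this).1
  · exact (List.cons.inj this).2

lemma sgm_range (w : FreeMonoid X) (hw : w ≠ 1) : ∃ z, sgm X z = w := by
  cases h : w.toList with
  | nil => exact absurd (FreeMonoid.toList.injective h) hw
  | cons x l =>
    refine ⟨⟨x, l⟩, ?_⟩
    rw [sgm_eq]
    exact FreeMonoid.toList.injective h.symm

/-- embedding in unital algebra -/
noncomputable def io (K X : Type*) [CommRing K] : FreeNUAlg K X →ₙₐ[K] UFA K X :=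
  MonoidAlgebra.mapDomainNonUnitalAlgHom K K (sgm X)

lemma io_apply (a : FreeNUAlg K X) : io K X a = MonoidAlgebra.mapDomain (sgm X) a := rfl

lemma io_inj : Function.Injective (io K X) := MonoidAlgebra.mapDomain_injective sgm_inj

lemma io_one (a : FreeNUAlg K X) : (io K X a).coeff 1 = 0 := by
  rw [io_apply]
  change (Finsupp.mapDomain _ _) _ = _
  apply Finsupp.mapDomain_of_notMem_range
  rintro ⟨z, hz⟩
  rw [sgm_eq] at hz
  have := congrArg FreeMonoid.length hz
  simp [FreeMonoid.length] at this

lemma io_decomp (b : UFA K X) : ∃ (k : K) (a : FreeNUAlg K X), b = algebraMap K _ k + io K X a := by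
  refine ⟨b.coeff 1, MonoidAlgebra.comapDomain (sgm X) sgm_inj (b.erase 1), ?_⟩
  rw [io_apply, MonoidAlgebra.mapDomain_comapDomain]
  · rw [MonoidAlgebra.coe_algebraMap]
    exact (MonoidAlgebra.single_add_erase _ _).symm
  · intro w hw
    apply sgm_range
    rintro rfl
    simp at hw

lemma io_unique {k : K} {a : FreeNUAlg K X} (h : algebraMap K _ k + io K X a = 0) :
    k = 0 ∧ a = 0 := by
  have h1 := congrArg (fun f => f.coeff 1) h
  rw [MonoidAlgebra.coe_algebraMap] at h1
  simp [io_one] at h1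
  subst h1
  rw [map_zero, zero_add] at h
  exact ⟨rfl, (map_eq_zero_iff _ io_inj).1 h⟩

end Glue

theorem subalgebra_of_finite_corank_not_free
    (K X : Type*) [CommRing K] [IsDomain K] [IsNoetherianRing K] [Nonempty X]
    (S : NonUnitalSubalgebra K (FreeNUAlg K X))
    (hne_top : S ≠ ⊤)
    (hcorank : Module.Finite K (FreeNUAlg K X ⧸ S.toSubmodule))
    (Y : Type*) :
    ¬ ∃ f : FreeNUAlg K Y →ₙₐ[K] S, Function.Bijective f := by
  rintro ⟨f, hfi, hfs⟩
  let j : UFA K Y →ₐ[K] UFA K X := MonoidAlgebra.lift K (UFA K X) (FreeMonoid Y)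
    (FreeMonoid.lift fun y => io K X (f (MonoidAlgebra.single (FreeSemigroup.of y) 1)))
  have hjio : ∀ a, j (io K Y a) = io K X (f a) := by
    intro a
    have hw : ∀ w : FreeSemigroup Y, j (MonoidAlgebra.single (sgm Y w) 1) =
        io K X (f (MonoidAlgebra.single w 1)) := by
      intro w
      induction w using FreeSemigroup.recOnMul with
      | ih1 x => simp [j, sgm]
      | ih2 x y h1 h2 =>
        have e1 : (MonoidAlgebra.single (sgm Y (FreeSemigroup.of x * y)) 1 : UFA K Y) =
          MonoidAlgebra.single (sgm Y (FreeSemigroup.of x)) 1 * MonoidAlgebra.single (sgm Y y) 1 := by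
          rw [MonoidAlgebra.single_mul_single, map_mul, one_mul]
        have e2 : (MonoidAlgebra.single (FreeSemigroup.of x * y) 1 : FreeNUAlg K Y) =
          MonoidAlgebra.single (FreeSemigroup.of x) 1 * MonoidAlgebra.single y 1 := by
          rw [MonoidAlgebra.single_mul_single, one_mul]
        rw [e1, e2, map_mul, map_mul, h1, h2, ← map_mul]
        rfl
    induction a using MonoidAlgebra.induction_linear with
    | zero => simp
    | add a b ha hb => simp only [map_add, ha, hb, NonUnitalSubalgebra.coe_add]
    | single w c =>
      have e : (MonoidAlgebra.single w c : FreeNUAlg K Y) = c • MonoidAlgebra.single w 1 := by simp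
      have e3 : io K Y (MonoidAlgebra.single w 1) = MonoidAlgebra.single (sgm Y w) 1 := by
        simp [io_apply]
      rw [e]
      simp only [map_smul, e3, hw, NonUnitalSubalgebra.coe_smul]
  have hj : Function.Injective j := by
    rw [injective_iff_map_eq_zero]
    intro b hb
    obtain ⟨k, a, rfl⟩ := io_decomp b
    rw [map_add, AlgHom.commutes, hjio] at hb
    obtain ⟨rfl, h2⟩ := io_unique hb
    have : a = 0 := hfi (by rw [map_zero]; exact Subtype.ext h2)
    simp [this]
  have hSub : S.toSubmodule ≤ (LinearMap.range j.toLinearMap).comap (io K X : FreeNUAlg K X →ₗ[K] UFA K X) := by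
    intro a ha
    obtain ⟨b, hb⟩ := hfs ⟨a, ha⟩
    refine ⟨io K Y b, ?_⟩
    rw [AlgHom.toLinearMap_apply, hjio, hb]
    rfl
  have hcor : Module.Finite K (UFA K X ⧸ LinearMap.range j.toLinearMap) := by
    refine Module.Finite.of_surjective (Submodule.mapQ _ _ _ hSub) ?_
    intro q
    obtain ⟨b, rfl⟩ := Submodule.mkQ_surjective _ q
    obtain ⟨k, a, rfl⟩ := io_decomp b
    refine ⟨Submodule.Quotient.mk a, ?_⟩
    rw [Submodule.mapQ_apply, Submodule.mkQ_apply, eq_comm, Submodule.Quotient.eq]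
    refine ⟨algebraMap K _ k, ?_⟩
    rw [AlgHom.toLinearMap_apply, AlgHom.commutes]
    exact (add_sub_cancel_right _ _).symm
  have : IsDomain (UFA K X) := NoZeroDivisors.to_isDomain _
  have : IsDomain (UFA K Y) := NoZeroDivisors.to_isDomain _
  have hsurj := core j hj hcor ufa_not_finite ufa_alg
  apply hne_top
  rw [eq_top_iff]
  intro a _
  obtain ⟨b, hb⟩ := hsurj (io K X a)
  obtain ⟨k, c, rfl⟩ := io_decomp b
  rw [map_add, AlgHom.commutes, hjio, ← sub_eq_zero, add_sub_assoc, ← map_sub] at hb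
  have := (io_unique hb).2
  rw [sub_eq_zero] at this
  rw [← this]
  exact (f c).2
end
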